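/- arXiv:2001.09103 — 7 statements merged into one kernel-verified Lean document; each statement's English description precedes it below -/
import Mathlib

section
/- There exists a real constant C > 0 such that for every positive integer ℓ and every integer n with n ≥ (3/2)·ℓ⁴ + C·ℓ³, every partial Mendelsohn triple system on a point set of cardinality n has a cyclic ℓ-good sequencing. -/
/-- The three ordered pairs contained in a 3-cycle `(x,y,z)`. -/
def cycPairs {V : Type} (t : V × V × V) : Set (V × V) :=
  {(t.1, t.2.1), (t.2.1, t.2.2), (t.2.2, t.1)}

/-- `t'` is a cyclic rotation of the 3-cycle `t`. -/
def cycRot {V : Type} (t t' : V × V × V) : Prop :=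
  t' = t ∨ t' = (t.2.1, t.2.2, t.1) ∨ t' = (t.2.2, t.1, t.2.1)

/-- Placing `y` at position `r` of the arrangement `σ` creates an `F`-triple all of whose positions
are pairwise near. -/
def Clashes {P V : Type*} (near : P → P → Prop) (F : V → V → V → Prop) (σ : P ≃ V)
    (y : V) (r : P) : Prop :=
  ∃ i j, i ≠ r ∧ j ≠ r ∧ near r i ∧ near r j ∧ near i j ∧ F y (σ i) (σ j)

/-- A symmetric reflexive relation on positions with neighbourhoods of size at most `d`. -/
structure BoundedNear {P : Type*} (near : P → P → Prop) (d : ℕ) : Prop where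
  refl : ∀ i, near i i
  symm : ∀ i j, near i j → near j i
  card_le : ∀ i, {j | near i j}.ncard ≤ d

/-- `F` is closed under rotation, holds only for pairwise distinct elements, and its last two
arguments determine the first. -/
structure IsCyclicSystem {V : Type*} (F : V → V → V → Prop) : Prop where
  rot : ∀ x y z, F x y z → F y z x
  ne : ∀ x y z, F x y z → x ≠ y
  unique : ∀ x x' y z, F x y z → F x' y z → x = x'

section Arrangement

variable {P V : Type*} {near : P → P → Prop} {F : V → V → V → Prop} {d : ℕ}

lemma Clashes.partner (hN : BoundedNear near d) (hF : IsCyclicSystem F) {σ : P ≃ V} {w : P}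
    (h : Clashes near F σ (σ w) w) :
    ∃ i j, i ≠ w ∧ j ≠ w ∧ near w i ∧ near w j ∧ near i j ∧ F (σ w) (σ i) (σ j) ∧
      Clashes near F σ (σ i) i ∧ Clashes near F σ (σ j) j := by
  obtain ⟨i, j, hi, hj, ni, nj, nij, hf⟩ := h
  have h1 := hF.rot _ _ _ hf
  have h2 := hF.rot _ _ _ h1
  have hij : i ≠ j := fun e => hF.ne _ _ _ h1 (by rw [e])
  exact ⟨i, j, hi, hj, ni, nj, nij, hf,
    ⟨j, w, hij.symm, hi.symm, nij, hN.symm _ _ ni, hN.symm _ _ nj, h1⟩,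
    ⟨w, i, hj.symm, hij, hN.symm _ _ nj, hN.symm _ _ nij, ni, h2⟩⟩

lemma Clashes.congr {σ σ' : P ≃ V} {y : V} {r : P}
    (h : ∀ i, i ≠ r → near r i → σ' i = σ i) (hc : Clashes near F σ' y r) :
    Clashes near F σ y r := by
  obtain ⟨i, j, hi, hj, ni, nj, nij, hf⟩ := hc
  exact ⟨i, j, hi, hj, ni, nj, nij, by rwa [h i hi ni, h j hj nj] at hf⟩

open Classical in
lemma not_clashes_swap {σ : P ≃ V} {u v : P} (huv : ¬ near v u) (h : ¬ Clashes near F σ (σ u) v) :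
    ¬ Clashes near F ((Equiv.swap u v).trans σ) (((Equiv.swap u v).trans σ) v) v := by
  intro hc
  rw [Equiv.trans_apply, Equiv.swap_apply_right] at hc
  refine h (hc.congr fun i hi ni => ?_)
  have : i ≠ u := fun e => huv (e ▸ ni)
  rw [Equiv.trans_apply, Equiv.swap_apply_of_ne_of_ne this hi]

variable [Fintype P]

open Classical in
lemma card_good_swap (hN : BoundedNear near d) (σ : P ≃ V) (u v : P) (y : V) :
    {r | ¬ Clashes near F σ y r}.ncard ≤
      {r | ¬ Clashes near F ((Equiv.swap u v).trans σ) y r}.ncard + 2 * d := by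
  have hsub : {r | ¬ Clashes near F σ y r} ⊆
      {r | ¬ Clashes near F ((Equiv.swap u v).trans σ) y r} ∪ ({r | near u r} ∪ {r | near v r}) := by
    intro r hr
    by_contra hcon
    simp only [Set.mem_union, Set.mem_ofPred_eq, not_or, not_not] at hcon hr
    obtain ⟨hc, hu, hv⟩ := hcon
    refine hr (hc.congr fun i _ ni => ?_)
    have h1 : i ≠ u := fun e => hu (hN.symm _ _ (e ▸ ni))
    have h2 : i ≠ v := fun e => hv (hN.symm _ _ (e ▸ ni))
    rw [Equiv.trans_apply, Equiv.swap_apply_of_ne_of_ne h1 h2]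
  have h1 := Set.ncard_le_ncard hsub (Set.toFinite _)
  have h2 := Set.ncard_union_le {r | ¬ Clashes near F ((Equiv.swap u v).trans σ) y r}
    ({r | near u r} ∪ {r | near v r})
  have h3 := Set.ncard_union_le {r | near u r} {r | near v r}
  have h4 := hN.card_le u
  have h5 := hN.card_le v
  omega

variable [Fintype V]

open Classical in
lemma card_clashes_le (hN : BoundedNear near d) (hF : IsCyclicSystem F) (σ : P ≃ V) (r : P) :
    {y | Clashes near F σ y r}.ncard ≤ d * d := by
  set N : Set P := {j | near r j}
  let f : P × P → V := fun p => if h : ∃ y, F y (σ p.1) (σ p.2) then h.choose else σ r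
  have hsub : {y | Clashes near F σ y r} ⊆ f '' (N ×ˢ N) := by
    rintro y ⟨i, j, -, -, hi, hj, -, hy⟩
    refine ⟨(i, j), ⟨hi, hj⟩, ?_⟩
    have h : ∃ y, F y (σ i) (σ j) := ⟨y, hy⟩
    simp only [f, dif_pos h]
    exact hF.unique _ _ _ _ h.choose_spec hy
  calc _ ≤ (f '' (N ×ˢ N)).ncard := Set.ncard_le_ncard hsub (Set.toFinite _)
    _ ≤ (N ×ˢ N).ncard := Set.ncard_image_le (Set.toFinite _)
    _ = N.ncard * N.ncard := Set.ncard_prod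
    _ ≤ d * d := Nat.mul_le_mul (hN.card_le r) (hN.card_le r)

open Classical in
/-- An element with many good positions can be swapped to a good position without creating any
new clash. -/
lemma exists_swap_clean (hN : BoundedNear near d) (hF : IsCyclicSystem F) (σ : P ≃ V) (u : P)
    (hK : d * d + d < {r | ¬ Clashes near F σ (σ u) r}.ncard) :
    ∃ r, (∀ w, Clashes near F ((Equiv.swap u r).trans σ) (((Equiv.swap u r).trans σ) w) w →
      Clashes near F σ (σ w) w ∧ w ≠ u ∧ w ≠ r) := by
  have hcard : ({r | Clashes near F σ (σ r) u} ∪ {r | near u r}).ncard <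
      {r | ¬ Clashes near F σ (σ u) r}.ncard := by
    have h1 := Set.ncard_union_le {r | Clashes near F σ (σ r) u} {r | near u r}
    have h2 : {r | Clashes near F σ (σ r) u}.ncard ≤ d * d := by
      refine le_trans ?_ (card_clashes_le hN hF σ u)
      exact Set.ncard_le_ncard_of_injOn σ (fun r hr => hr) σ.injective.injOn (Set.toFinite _)
    have h3 := hN.card_le u
    omega
  obtain ⟨r, hr, hr'⟩ := Set.exists_mem_notMem_of_ncard_lt_ncard hcard (Set.toFinite _)
  simp only [Set.mem_union, Set.mem_ofPred_eq, not_or] at hr hr'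
  refine ⟨r, ?_⟩
  have hcr := not_clashes_swap (fun h => hr'.2 (hN.symm _ _ h)) hr
  have hcu := not_clashes_swap hr'.2 hr'.1
  rw [Equiv.swap_comm] at hcu
  intro w hw
  have hwu : w ≠ u := fun e => hcu (e ▸ hw)
  have hwr : w ≠ r := fun e => hcr (e ▸ hw)
  obtain ⟨i, j, hi, hj, ni, nj, nij, hf, hci, hcj⟩ := hw.partner hN hF
  have key : ∀ x, Clashes near F ((Equiv.swap u r).trans σ) (((Equiv.swap u r).trans σ) x) x →
      ((Equiv.swap u r).trans σ) x = σ x := fun x hx => by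
    have hxu : x ≠ u := fun e => hcu (e ▸ hx)
    have hxr : x ≠ r := fun e => hcr (e ▸ hx)
    rw [Equiv.trans_apply, Equiv.swap_apply_of_ne_of_ne hxu hxr]
  rw [key i hci, key j hcj, key w hw] at hf
  exact ⟨⟨i, j, hi, hj, ni, nj, nij, hf⟩, hwu, hwr⟩

open Classical in
lemma exists_clean_on (hN : BoundedNear near d) (hF : IsCyclicSystem F) :
    ∀ (s : ℕ) (S : Finset P) (σ : P ≃ V), S.card ≤ s →
    (∀ u ∈ S, d * d + d + s * (2 * d) < {r | ¬ Clashes near F σ (σ u) r}.ncard) →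
    ∃ σ' : P ≃ V, ∀ w, Clashes near F σ' (σ' w) w → Clashes near F σ (σ w) w ∧ w ∉ S := by
  intro s
  induction s with
  | zero =>
    intro S σ hS _
    have : S = ∅ := Finset.card_eq_zero.mp (by omega)
    exact ⟨σ, fun w hw => ⟨hw, by simp [this]⟩⟩
  | succ s ih =>
    intro S σ hS hK
    rcases S.eq_empty_or_nonempty with rfl | ⟨u, hu⟩
    · exact ⟨σ, fun w hw => ⟨hw, by simp⟩⟩
    obtain ⟨r, hr⟩ := exists_swap_clean hN hF σ u (lt_of_le_of_lt (by omega) (hK u hu))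
    obtain ⟨σ', hσ'⟩ := ih ((S.erase u).erase r) ((Equiv.swap u r).trans σ)
      (by
        have h1 := Finset.card_erase_le (s := S.erase u) (a := r)
        have h2 := Finset.card_erase_of_mem hu
        omega)
      (by
        intro v hv
        simp only [Finset.mem_erase] at hv
        have h1 := hK v hv.2.2
        have h2 := card_good_swap (F := F) hN σ u r (σ v)
        rw [Equiv.trans_apply, Equiv.swap_apply_of_ne_of_ne hv.2.1 hv.1]
        rw [Nat.succ_mul] at h1
        omega)
    refine ⟨σ', fun w hw => ?_⟩
    obtain ⟨h1, h2⟩ := hσ' w hw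
    obtain ⟨h3, h4, h5⟩ := hr w h1
    exact ⟨h3, fun h => h2 (by simp [h, h4, h5])⟩

open Classical in
/-- Few elements clash with more than half of the positions. -/
lemma card_mostly_clashing_le (hN : BoundedNear near d) (hF : IsCyclicSystem F) (σ : P ≃ V) (K : ℕ)
    (hK : 2 * K ≤ Fintype.card P) (hP : 0 < Fintype.card P) :
    {y | {r | ¬ Clashes near F σ y r}.ncard ≤ K}.ncard ≤ 2 * (d * d) := by
  set D : Finset V := Finset.univ.filter fun y => {r | ¬ Clashes near F σ y r}.ncard ≤ K with hD
  have hDc : {y | {r | ¬ Clashes near F σ y r}.ncard ≤ K}.ncard = D.card := by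
    rw [← Set.ncard_coe_finset]; congr 1; ext; simp [hD]
  rw [hDc]
  have hdc := Finset.sum_card_bipartiteAbove_eq_sum_card_bipartiteBelow
    (s := D) (t := (Finset.univ : Finset P)) (fun y r => Clashes near F σ y r)
  have hlow : D.card * (Fintype.card P - K) ≤
      ∑ y ∈ D, (Finset.bipartiteAbove (fun y r => Clashes near F σ y r) Finset.univ y).card := by
    rw [← smul_eq_mul]
    refine Finset.card_nsmul_le_sum _ _ _ fun y hy => ?_
    have hy' : {r | ¬ Clashes near F σ y r}.ncard ≤ K := by simpa [hD] using hy
    have e : {r | ¬ Clashes near F σ y r}.ncard =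
        (Finset.univ.filter fun r => ¬ Clashes near F σ y r).card := by
      rw [← Set.ncard_coe_finset]; congr 1; ext; simp
    have := Finset.card_filter_add_card_filter_not (s := (Finset.univ : Finset P))
      (fun r => Clashes near F σ y r)
    rw [Finset.card_univ] at this
    unfold Finset.bipartiteAbove
    beta_reduce
    omega
  have hup : ∑ r : P, (Finset.bipartiteBelow (fun y r => Clashes near F σ y r) D r).card ≤
      Fintype.card P * (d * d) := by
    rw [← smul_eq_mul, ← Finset.card_univ]
    refine Finset.sum_le_card_nsmul _ _ _ fun r _ => ?_
    refine le_trans ?_ (card_clashes_le hN hF σ r)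
    rw [← Set.ncard_coe_finset]
    refine Set.ncard_le_ncard (fun y hy => ?_) (Set.toFinite _)
    simp only [Finset.bipartiteBelow, Finset.coe_filter, Set.mem_ofPred_eq] at hy
    exact hy.2
  have h1 : D.card * (Fintype.card P - K) ≤ Fintype.card P * (d * d) := by
    exact hlow.trans (hdc.le.trans hup)
  have h2 : D.card * Fintype.card P ≤ D.card * (2 * (Fintype.card P - K)) :=
    Nat.mul_le_mul_left _ (by omega)
  refine Nat.le_of_mul_le_mul_right (c := Fintype.card P) ?_ hP
  nlinarith

open Classical in
lemma exists_fewer_clashes (hN : BoundedNear near d) (hF : IsCyclicSystem F) (hd : 0 < d)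
    (hn : 14 * d ^ 3 ≤ Fintype.card P) (σ : P ≃ V) (p : P) :
    ∃ σ' : P ≃ V, ∀ w, Clashes near F σ' (σ' w) w → Clashes near F σ (σ w) w ∧ w ≠ p := by
  have hd2 : d ^ 2 ≤ d ^ 3 := Nat.pow_le_pow_right hd (by norm_num)
  have hd1 : d ≤ d ^ 2 := Nat.le_self_pow (by norm_num) d
  set K := d * d + d + d * (2 * d) + 2 * d with hK
  set D : Set V := {y | {r | ¬ Clashes near F σ y r}.ncard ≤ K} with hD
  by_cases hp : σ p ∈ D
  · have hDc : D.ncard ≤ 2 * (d * d) :=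
      card_mostly_clashing_le hN hF σ K (by nlinarith) (by nlinarith)
    let A : Set P := ⋃ y ∈ D, {j | near (σ.symm y) j}
    have hA : A.ncard ≤ 2 * (d * d) * d := by
      have h1 : A.ncard ≤ D.ncard * d := by
        have e : A = ↑(D.toFinset.biUnion fun y => Finset.univ.filter fun j => near (σ.symm y) j) := by
          ext; simp [A]
        rw [e, Set.ncard_coe_finset, Set.ncard_eq_toFinset_card']
        refine Finset.card_biUnion_le_card_mul _ _ _ fun y _ => ?_
        rw [← Set.ncard_coe_finset]
        simpa using hN.card_le (σ.symm y)
      exact h1.trans (Nat.mul_le_mul_right _ hDc)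
    have hB : {r | Clashes near F σ (σ r) p}.ncard ≤ d * d := by
      refine le_trans ?_ (card_clashes_le hN hF σ p)
      exact Set.ncard_le_ncard_of_injOn σ (fun r hr => hr) σ.injective.injOn (Set.toFinite _)
    have hlt : (A ∪ {r | Clashes near F σ (σ r) p}).ncard < (Set.univ : Set P).ncard := by
      rw [Set.ncard_univ, Nat.card_eq_fintype_card]
      have := Set.ncard_union_le A {r | Clashes near F σ (σ r) p}
      have h3 : 0 < d ^ 3 := by positivity
      nlinarith
    obtain ⟨q, -, hq⟩ := Set.exists_mem_notMem_of_ncard_lt_ncard hlt (Set.toFinite _)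
    simp only [Set.mem_union, Set.mem_ofPred_eq, not_or] at hq
    obtain ⟨hqA, hqp⟩ := hq
    have hqD : ∀ j, near q j → σ j ∉ D := fun j hj hjD =>
      hqA (Set.mem_biUnion hjD (by simpa using hN.symm _ _ hj))
    have hnpq : ¬ near p q := fun h => hqD p (hN.symm _ _ h) hp
    set σ₁ := (Equiv.swap p q).trans σ with hσ₁
    have hcp : ¬ Clashes near F σ₁ (σ₁ p) p := by
      have := not_clashes_swap (F := F) hnpq hqp
      rwa [Equiv.swap_comm] at this
    let S : Finset P := (Finset.univ.filter fun j => near q j).erase q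
    have hsame : ∀ x, x ≠ p → x ≠ q → σ₁ x = σ x := fun x h1 h2 => by
      rw [hσ₁, Equiv.trans_apply, Equiv.swap_apply_of_ne_of_ne h1 h2]
    obtain ⟨σ', hσ'⟩ := exists_clean_on hN hF d S σ₁
      (by
        refine (Finset.card_erase_le).trans ?_
        rw [← Set.ncard_coe_finset]
        simpa using hN.card_le q)
      (by
        intro u hu
        simp only [S, Finset.mem_erase, Finset.mem_filter, Finset.mem_univ, true_and] at hu
        have hup : u ≠ p := fun e => hnpq (hN.symm _ _ (e ▸ hu.2))
        have h1 := hqD u hu.2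
        simp only [hD, Set.mem_ofPred_eq, not_le] at h1
        have h2 := card_good_swap (F := F) hN σ p q (σ u)
        rw [hsame u hup hu.1]
        rw [← hσ₁] at h2
        omega)
    refine ⟨σ', fun w hw => ?_⟩
    have hS : ∀ x, near q x → x ≠ q → ¬ Clashes near F σ' (σ' x) x := fun x h1 h2 h3 =>
      (hσ' x h3).2 (by simp [S, h1, h2])
    have hwq : ¬ near q w := by
      intro h
      rcases eq_or_ne w q with rfl | hne
      · obtain ⟨i, -, hi, -, ni, -, -, -, hci, -⟩ := hw.partner hN hF
        exact hS i ni hi hci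
      · exact hS w h hne hw
    have hw1 := (hσ' w hw).1
    have hwp : w ≠ p := fun e => hcp (e ▸ hw1)
    refine ⟨?_, hwp⟩
    obtain ⟨i, j, hi, hj, ni, nj, nij, hf, hci, hcj⟩ := hw1.partner hN hF
    have hwq' : w ≠ q := fun e => hwq (e ▸ hN.refl q)
    rw [hsame w hwp hwq', hsame i (fun e => hcp (e ▸ hci)) (fun e => hwq (hN.symm _ _ (e ▸ ni))),
      hsame j (fun e => hcp (e ▸ hcj)) (fun e => hwq (hN.symm _ _ (e ▸ nj)))] at hf
    exact ⟨i, j, hi, hj, ni, nj, nij, hf⟩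
  · simp only [hD, Set.mem_ofPred_eq, not_le] at hp
    obtain ⟨r, hr⟩ := exists_swap_clean hN hF σ p (lt_of_le_of_lt (by omega) hp)
    exact ⟨_, fun w hw => ⟨(hr w hw).1, (hr w hw).2.1⟩⟩

/-- If there are many more positions than near pairs per position, some arrangement has no
near triple in the system. -/
theorem exists_clash_free (hN : BoundedNear near d) (hF : IsCyclicSystem F) (hd : 0 < d)
    (hn : 14 * d ^ 3 ≤ Fintype.card P) (σ₀ : P ≃ V) :
    ∃ σ : P ≃ V, ∀ w, ¬ Clashes near F σ (σ w) w := by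
  obtain ⟨σ, hσ⟩ : ∃ σ : P ≃ V, ∀ σ' : P ≃ V, {w | Clashes near F σ (σ w) w}.ncard ≤
      {w | Clashes near F σ' (σ' w) w}.ncard := by
    have : Nonempty (P ≃ V) := ⟨σ₀⟩
    exact ⟨_, fun σ' =>
      Function.argmin_le (fun σ : P ≃ V => {w | Clashes near F σ (σ w) w}.ncard) σ'⟩
  refine ⟨σ, fun p hp => ?_⟩
  obtain ⟨σ', h⟩ := exists_fewer_clashes hN hF hd hn σ p
  refine absurd (hσ σ') (not_le.mpr (Set.ncard_lt_ncard ?_ (Set.toFinite _)))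
  exact ⟨fun w hw => (h w hw).1, fun hsub => (h p (hsub hp)).2 rfl⟩

end Arrangement

/-- `t` or one of its rotations is `(x, y, z)`. -/
def CycleIn {V : Type} (M : Set (V × V × V)) (x y z : V) : Prop :=
  (x, y, z) ∈ M ∨ (y, z, x) ∈ M ∨ (z, x, y) ∈ M

lemma isCyclicSystem_cycleIn {V : Type} (M : Set (V × V × V))
    (hne : ∀ t ∈ M, t.1 ≠ t.2.1 ∧ t.1 ≠ t.2.2 ∧ t.2.1 ≠ t.2.2)
    (huniq : ∀ t ∈ M, ∀ t' ∈ M, ∀ p : V × V, p ∈ cycPairs t → p ∈ cycPairs t' → cycRot t t') :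
    IsCyclicSystem (CycleIn M) where
  rot x y z h := by unfold CycleIn at *; tauto
  ne x y z h := by
    rcases h with h | h | h
    · exact (hne _ h).1
    · exact (hne _ h).2.1.symm
    · exact (hne _ h).2.2
  unique x x' y z h h' := by
    have key : ∀ x, CycleIn M x y z → ∃ t ∈ M, (y, z) ∈ cycPairs t ∧ cycRot t (x, y, z) := by
      rintro x (h | h | h)
      · exact ⟨_, h, by simp [cycPairs], by simp [cycRot]⟩
      · exact ⟨_, h, by simp [cycPairs], by simp [cycRot]⟩
      · exact ⟨_, h, by simp [cycPairs], by simp [cycRot]⟩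
    obtain ⟨t, ht, hp, hr⟩ := key x h
    obtain ⟨t', ht', hp', hr'⟩ := key x' h'
    have hq := huniq t ht t' ht' _ hp hp'
    have hn := hne t ht
    obtain ⟨a, b, c⟩ := t
    obtain ⟨a', b', c'⟩ := t'
    simp only [cycRot, Prod.mk.injEq] at hr hr' hq
    simp only at hn
    grind

/-- Cyclic distance less than `ℓ`. -/
def CyclicNear (n ℓ : ℕ) (i j : ZMod n) : Prop :=
  ∃ t < ℓ, j = i + (t : ZMod n) ∨ i = j + (t : ZMod n)

lemma boundedNear_cyclicNear (n ℓ : ℕ) [NeZero n] (hℓ : 0 < ℓ) :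
    BoundedNear (CyclicNear n ℓ) (2 * ℓ) where
  refl i := ⟨0, hℓ, by simp⟩
  symm i j := by
    rintro ⟨t, ht, h⟩
    exact ⟨t, ht, h.symm⟩
  card_le i := by
    have hsub : {j | CyclicNear n ℓ i j} ⊆
        ((Finset.range ℓ).image (fun t : ℕ => i + (t : ZMod n)) ∪
          (Finset.range ℓ).image (fun t : ℕ => i - (t : ZMod n)) : Finset (ZMod n)) := by
      rintro j ⟨t, ht, h | h⟩
      · simp only [Finset.coe_union, Finset.coe_image, Set.mem_union, Set.mem_image]
        exact Or.inl ⟨t, by simpa using ht, h.symm⟩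
      · simp only [Finset.coe_union, Finset.coe_image, Set.mem_union, Set.mem_image]
        exact Or.inr ⟨t, by simpa using ht, by rw [h]; ring⟩
    refine (Set.ncard_le_ncard hsub (Set.toFinite _)).trans ?_
    rw [Set.ncard_coe_finset]
    refine (Finset.card_union_le _ _).trans ?_
    have h1 := Finset.card_image_le (s := Finset.range ℓ) (f := fun t : ℕ => i + (t : ZMod n))
    have h2 := Finset.card_image_le (s := Finset.range ℓ) (f := fun t : ℕ => i - (t : ZMod n))
    rw [Finset.card_range] at h1 h2
    omega

lemma cyclicNear_add (n ℓ : ℕ) (i : ZMod n) {s t : ℕ} (hs : s < ℓ) (ht : t < ℓ) :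
    CyclicNear n ℓ (i + s) (i + t) := by
  rcases le_total s t with h | h
  · refine ⟨t - s, by omega, Or.inl ?_⟩
    rw [Nat.cast_sub h]; ring
  · refine ⟨s - t, by omega, Or.inr ?_⟩
    rw [Nat.cast_sub h]; ring

/-- The list of the values of an arrangement, starting at position `0`. -/
def arrangementList {V : Type} (n : ℕ) (σ : ZMod n ≃ V) : List V :=
  (List.range n).map fun k : ℕ => σ (k : ZMod n)

lemma nodup_arrangementList {V : Type} (n : ℕ) (σ : ZMod n ≃ V) : (arrangementList n σ).Nodup := by
  refine List.Nodup.map_on (fun a ha b hb h => ?_) List.nodup_range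
  have := σ.injective h
  rw [ZMod.natCast_eq_natCast_iff'] at this
  rwa [Nat.mod_eq_of_lt (List.mem_range.mp ha), Nat.mod_eq_of_lt (List.mem_range.mp hb)] at this

lemma mem_arrangementList {V : Type} (n : ℕ) [NeZero n] (σ : ZMod n ≃ V) (v : V) :
    v ∈ arrangementList n σ :=
  List.mem_map.mpr ⟨(σ.symm v).val, List.mem_range.mpr (ZMod.val_lt _), by simp⟩

lemma exists_of_mem_take_rotate {V : Type} (n : ℕ) (σ : ZMod n ≃ V) {i m : ℕ} {v : V}
    (h : v ∈ ((arrangementList n σ).rotate i).take m) :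
    ∃ t < m, v = σ ((i : ZMod n) + (t : ZMod n)) := by
  obtain ⟨t, ht, rfl⟩ := List.mem_iff_getElem.mp h
  have ht' : t < m := by
    rw [List.length_take] at ht; omega
  refine ⟨t, ht', ?_⟩
  simp only [List.getElem_take, List.getElem_rotate, arrangementList, List.getElem_map,
    List.getElem_range, List.length_map, List.length_range]
  congr 1
  rw [ZMod.natCast_mod]
  push_cast
  ring

/-- there is a constant `C > 0` such that every partial
Mendelsohn triple system on `n ≥ (3/2)·ℓ⁴ + C·ℓ³` points has a cyclic
`ℓ`-good sequencing. -/
theorem stmt_10 :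
    ∃ C : ℝ, 0 < C ∧ ∀ (ℓ n : ℕ), 0 < ℓ →
      (n : ℝ) ≥ (3 / 2 : ℝ) * (ℓ : ℝ) ^ 4 + C * (ℓ : ℝ) ^ 3 →
      ∀ (V : Type) [Fintype V] [DecidableEq V], Fintype.card V = n →
      ∀ M : Set (V × V × V),
        (∀ t ∈ M, t.1 ≠ t.2.1 ∧ t.1 ≠ t.2.2 ∧ t.2.1 ≠ t.2.2) →
        (∀ t ∈ M, ∀ t' ∈ M, ∀ p : V × V,
          p ∈ cycPairs t → p ∈ cycPairs t' → cycRot t t') →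
        ∃ xs : List V, xs.Nodup ∧ (∀ v : V, v ∈ xs) ∧
          ∀ i m : ℕ, m ≤ ℓ → m ≤ xs.length → ∀ t ∈ M,
            ¬ List.Sublist [t.1, t.2.1, t.2.2] ((xs.rotate i).take m) ∧
            ¬ List.Sublist [t.2.1, t.2.2, t.1] ((xs.rotate i).take m) ∧
            ¬ List.Sublist [t.2.2, t.1, t.2.1] ((xs.rotate i).take m) := by
  refine ⟨112, by norm_num, fun ℓ n hℓ hn V _ _ hV M hne huniq => ?_⟩
  have hnR : ((14 * (2 * ℓ) ^ 3 : ℕ) : ℝ) ≤ (n : ℝ) := by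
    push_cast
    have : (0 : ℝ) ≤ (ℓ : ℝ) ^ 4 := by positivity
    nlinarith
  have hn' : 14 * (2 * ℓ) ^ 3 ≤ n := by exact_mod_cast hnR
  have hpos : 0 < n := lt_of_lt_of_le (by positivity) hn'
  have : NeZero n := ⟨hpos.ne'⟩
  have hcard : Fintype.card (ZMod n) = Fintype.card V := by rw [ZMod.card, hV]
  obtain ⟨σ, hσ⟩ := exists_clash_free (boundedNear_cyclicNear n ℓ hℓ)
    (isCyclicSystem_cycleIn M hne huniq) (by omega) (by rwa [ZMod.card])
    (Fintype.equivOfCardEq hcard)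
  refine ⟨arrangementList n σ, nodup_arrangementList n σ, mem_arrangementList n σ, ?_⟩
  intro i m hm _
  have key : ∀ x y z, CycleIn M x y z →
      ¬ List.Sublist [x, y, z] (((arrangementList n σ).rotate i).take m) := by
    intro x y z hF hsub
    have hrot := (isCyclicSystem_cycleIn M hne huniq).rot
    have hne' := (isCyclicSystem_cycleIn M hne huniq).ne
    obtain ⟨a, ha, rfl⟩ := exists_of_mem_take_rotate n σ (hsub.subset (by simp : x ∈ [x, y, z]))
    obtain ⟨b, hb, rfl⟩ := exists_of_mem_take_rotate n σ (hsub.subset (by simp : y ∈ [_, y, z]))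
    obtain ⟨c, hc, rfl⟩ := exists_of_mem_take_rotate n σ (hsub.subset (by simp : z ∈ [_, _, z]))
    refine hσ _ ⟨_, _, fun e => hne' _ _ _ hF (by rw [e]),
      fun e => hne' _ _ _ (hrot _ _ _ (hrot _ _ _ hF)) (by rw [e]), ?_, ?_, ?_, hF⟩ <;>
    exact cyclicNear_add n ℓ _ (by omega) (by omega)
  intro t ht
  exact ⟨key _ _ _ (Or.inl ht), key _ _ _ (Or.inr (Or.inr ht)), key _ _ _ (Or.inr (Or.inl ht))⟩
end

section
/- Let t, k and λ be fixed integers with 2 ≤ t < k and λ ≥ 1. There exists a real constant C > 0 such that for every integer ℓ ≥ k and every integer n with n ≥ C·ℓ^(2t), every design S_λ(t,k,n) has a cyclic ℓ-good sequencing. -/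
/-- The points `z` completing some block of `B` inside `insert z S`. -/
def completingPoints {V : Type*} [Fintype V] [DecidableEq V] (B : Finset (Finset V))
    (S : Finset V) : Finset V :=
  Finset.univ.filter fun z => ∃ b ∈ B, z ∈ b ∧ b ⊆ insert z S

/-- `f`, viewed as an assignment of points to the positions in `P` only, is injective and no
window `W i` contains all points of a block. -/
def IsGoodOn {α V ι : Type*} [DecidableEq α] [DecidableEq V] (W : ι → Finset α)
    (B : Finset (Finset V)) (P : Finset α) (f : α → V) : Prop :=
  Set.InjOn f P ∧ ∀ i, ∀ b ∈ B, ¬ b ⊆ (W i ∩ P).image f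

section Assignment

variable {α V ι : Type*} [DecidableEq α] [Fintype V] [DecidableEq V]
  {W : ι → Finset α} {B : Finset (Finset V)} {N : α → Finset α}

/-- A good partial assignment may be extended simultaneously to pairwise separated positions, as
long as each new point completes no block near its position. -/
theorem IsGoodOn.union {P U : Finset α} {f g : α → V} (hf : IsGoodOn W B P f)
    (hN : ∀ i, ∀ p ∈ W i, W i ⊆ N p) (hPU : Disjoint P U) (hg : Set.InjOn g U)
    (hgf : ∀ u ∈ U, g u ∉ P.image f)
    (hsep : ∀ u ∈ U, ∀ v ∈ U, v ∈ N u → v = u)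
    (hbad : ∀ u ∈ U, g u ∉ completingPoints B ((N u ∩ P).image f)) :
    IsGoodOn W B (P ∪ U) (fun p => if p ∈ U then g p else f p) := by
  have hnot : ∀ p ∈ P, p ∉ U := fun p hp hu => Finset.disjoint_left.1 hPU hp hu
  refine ⟨?_, ?_⟩
  · intro x hx y hy hxy
    simp only [Finset.coe_union, Set.mem_union, Finset.mem_coe] at hx hy
    by_cases hxU : x ∈ U <;> by_cases hyU : y ∈ U <;> simp only [hxU, hyU, if_true, if_false] at hxy
    · exact hg hxU hyU hxy
    · exact absurd (Finset.mem_image.2 ⟨y, hy.resolve_right hyU, hxy.symm⟩) (hgf x hxU)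
    · exact absurd (Finset.mem_image.2 ⟨x, hx.resolve_right hxU, hxy⟩) (hgf y hyU)
    · exact hf.1 (hx.resolve_right hxU) (hy.resolve_right hyU) hxy
  · intro i b hb hsub
    by_cases hu : ∃ u ∈ U, u ∈ W i
    · obtain ⟨u, huU, huW⟩ := hu
      have key : ∀ v ∈ b, v = g u ∨ v ∈ (W i ∩ P).image f := by
        intro v hv
        obtain ⟨p, hp, rfl⟩ := Finset.mem_image.1 (hsub hv)
        rw [Finset.mem_inter, Finset.mem_union] at hp
        by_cases hpU : p ∈ U
        · left
          simp only [hpU, if_true]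
          rw [hsep u huU p hpU (hN i u huW hp.1)]
        · right
          simp only [hpU, if_false]
          exact Finset.mem_image_of_mem _
            (Finset.mem_inter.2 ⟨hp.1, hp.2.resolve_right hpU⟩)
      by_cases hgb : g u ∈ b
      · refine hbad u huU (Finset.mem_filter.2 ⟨Finset.mem_univ _, b, hb, hgb, fun v hv => ?_⟩)
        rcases key v hv with h | h
        · exact h ▸ Finset.mem_insert_self _ _
        · exact Finset.mem_insert_of_mem
            (Finset.image_subset_image (Finset.inter_subset_inter_right (hN i u huW)) h)
      · refine hf.2 i b hb fun v hv => (key v hv).resolve_left ?_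
        rintro rfl
        exact hgb hv
    · push Not at hu
      refine hf.2 i b hb fun v hv => ?_
      obtain ⟨p, hp, rfl⟩ := Finset.mem_image.1 (hsub hv)
      rw [Finset.mem_inter, Finset.mem_union] at hp
      have hpU : p ∉ U := fun h => hu p h hp.1
      simp only [hpU, if_false]
      exact Finset.mem_image_of_mem _ (Finset.mem_inter.2 ⟨hp.1, hp.2.resolve_right hpU⟩)

/-- Greedy extension: a good partial assignment extends to any larger set of positions leaving at
least `D` points unused. -/
theorem IsGoodOn.extend {D : ℕ} (hN : ∀ i, ∀ p ∈ W i, W i ⊆ N p)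
    (hD : ∀ p, ∀ (P : Finset α) (f : α → V),
      (completingPoints B ((N p ∩ P).image f)).card ≤ D)
    {P : Finset α} {f : α → V} (hf : IsGoodOn W B P f) (R : Finset α) (hPR : Disjoint P R)
    (hcard : (P ∪ R).card + D ≤ Fintype.card V) :
    ∃ f', IsGoodOn W B (P ∪ R) f' ∧ ∀ p ∈ P, f' p = f p := by
  induction R using Finset.induction_on with
  | empty => exact ⟨f, by simpa using hf, fun _ _ => rfl⟩
  | insert r R hr ih =>
    rw [Finset.disjoint_insert_right] at hPR
    have hrP : r ∉ P ∪ R := by simp [hr, hPR.1]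
    rw [Finset.union_insert, Finset.card_insert_of_notMem hrP] at hcard
    obtain ⟨f', hf', hff'⟩ := ih hPR.2 (by omega)
    obtain ⟨z, hz⟩ : ∃ z, z ∉ (P ∪ R).image f' ∪
        completingPoints B ((N r ∩ (P ∪ R)).image f') := by
      by_contra! h
      have h1 := Finset.card_union_le ((P ∪ R).image f')
        (completingPoints B ((N r ∩ (P ∪ R)).image f'))
      rw [Finset.eq_univ_iff_forall.2 h, Finset.card_univ] at h1
      have h2 := Finset.card_image_le (s := P ∪ R) (f := f')
      have h3 := hD r (P ∪ R) f'
      omega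
    rw [Finset.mem_union, not_or] at hz
    have := hf'.union (U := {r}) (g := fun _ => z) hN (by simpa using hrP) (by simp)
      (by simpa using hz.1) (by simp) (by simpa using hz.2)
    refine ⟨_, by rwa [Finset.union_insert, Finset.insert_eq, Finset.union_comm {r}], ?_⟩
    intro p hp
    have : p ≠ r := fun h => hPR.1 (h ▸ hp)
    simp [this, hff' p hp]

/-- A system of windows on positions admits an assignment of all points avoiding blocks in windows
as soon as it has `4 * D` pairwise separated positions, where `D` bounds the number of points
completing a block near a given position. -/
theorem exists_injective_avoiding [Fintype α] (hcard : Fintype.card α = Fintype.card V)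
    (hB : ∀ b ∈ B, 2 ≤ b.card) {D : ℕ} (hN : ∀ i, ∀ p ∈ W i, W i ⊆ N p)
    (hself : ∀ p, p ∈ N p)
    (hD : ∀ p, ∀ (P : Finset α) (f : α → V),
      (completingPoints B ((N p ∩ P).image f)).card ≤ D)
    (Q U : Finset α) (hQ : Q.card = 2 * D) (hU : U.card = 2 * D)
    (hQU : Disjoint Q U)
    (hsep : ∀ p ∈ Q ∪ U, ∀ q ∈ Q ∪ U, p ≠ q → Disjoint (N p) (N q)) :
    ∃ f : α → V, Function.Injective f ∧ ∀ i, ∀ b ∈ B, ¬ b ⊆ (W i).image f := by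
  have hsep' : ∀ p ∈ Q ∪ U, ∀ q ∈ Q ∪ U, q ∈ N p → q = p := by
    intro p hp q hq h
    by_contra hne
    exact Finset.disjoint_left.1 (hsep p hp q hq (Ne.symm hne)) h (hself q)
  have hn : ∀ P : Finset α, Disjoint P Q → P.card + 2 * D ≤ Fintype.card V := by
    intro P hP
    rw [← hQ, ← Finset.card_union_of_disjoint hP, ← hcard]
    exact Finset.card_le_univ _
  have h0 : IsGoodOn W B ∅ (Fintype.equivOfCardEq hcard) := by
    refine ⟨by simp, fun i b hb h => ?_⟩
    have := hB b hb
    simp_all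
  -- fill the neighbourhoods of the holes `Q`
  set P₁ := Q.biUnion N \ Q with hP₁
  have hP₁Q : Disjoint P₁ Q := Finset.sdiff_disjoint
  obtain ⟨f₁, hf₁, -⟩ := h0.extend hN hD P₁ (by simp)
    (by rw [Finset.empty_union]; have := hn P₁ hP₁Q; omega)
  rw [Finset.empty_union] at hf₁
  have hNQ : ∀ q ∈ Q, ∀ P, P₁ ⊆ P → Disjoint P Q → N q ∩ P = N q ∩ P₁ := by
    intro q hq P hP hPQ
    ext x
    simp only [Finset.mem_inter, hP₁, Finset.mem_sdiff, Finset.mem_biUnion]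
    refine ⟨fun h => ⟨h.1, ⟨q, hq, h.1⟩, Finset.disjoint_left.1 hPQ h.2⟩, fun h => ⟨h.1, hP ?_⟩⟩
    simpa [hP₁] using h.2
  set bad : α → Finset V := fun q => completingPoints B ((N q ∩ P₁).image f₁) with hbad
  -- the points bad for many holes are few; place them at positions of `U`
  set hard : Finset V := (Finset.univ \ P₁.image f₁).filter
    fun z => D < (Q.filter fun q => z ∈ bad q).card with hhard
  have hhard_card : hard.card ≤ 2 * D := by
    have h1 : hard.card * (D + 1) ≤ ∑ z ∈ hard, (Q.filter fun q => z ∈ bad q).card := by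
      rw [← smul_eq_mul]
      exact Finset.card_nsmul_le_sum _ _ _ fun z hz => (Finset.mem_filter.1 hz).2
    have h2 : ∑ z ∈ hard, (Q.filter fun q => z ∈ bad q).card ≤ ∑ q ∈ Q, (bad q).card := by
      refine (Finset.sum_card_bipartiteAbove_eq_sum_card_bipartiteBelow
        (s := Q) (t := hard) (fun q z => z ∈ bad q)).symm.trans_le ?_
      refine Finset.sum_le_sum fun q _ => Finset.card_le_card fun z hz => ?_
      exact (Finset.mem_filter.1 hz).2
    have h3 : ∑ q ∈ Q, (bad q).card ≤ 2 * D * D := by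
      rw [← hQ, ← smul_eq_mul]
      exact Finset.sum_le_card_nsmul _ _ _ fun q _ => hD q _ _
    nlinarith
  obtain ⟨U', hU'U, hU'⟩ := Finset.exists_subset_card_eq (hhard_card.trans hU.ge)
  obtain ⟨g, hg, hgimg⟩ : ∃ g : α → V, Set.InjOn g U' ∧ U'.image g = hard := by
    have e := Finset.equivOfCardEq hU'
    refine ⟨fun x => if h : x ∈ U' then (e ⟨x, h⟩ : V) else f₁ x, ?_, ?_⟩
    · intro x hx y hy hxy
      rw [Finset.mem_coe] at hx hy
      simpa [hx, hy, Subtype.coe_inj] using hxy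
    · ext z
      rw [Finset.mem_image]
      constructor
      · rintro ⟨x, hx, rfl⟩
        simp [hx]
      · intro hz
        exact ⟨e.symm ⟨z, hz⟩, (e.symm ⟨z, hz⟩).2, by simp⟩
  have hgU : ∀ u ∈ U', g u ∈ hard := fun u hu => hgimg ▸ Finset.mem_image_of_mem g hu
  have hUP : ∀ u ∈ U, N u ∩ P₁ = ∅ := by
    intro u hu
    rw [← Finset.disjoint_iff_inter_eq_empty, Finset.disjoint_left]
    intro x hx hxP
    obtain ⟨q, hq, hxq⟩ := Finset.mem_biUnion.1 (Finset.mem_sdiff.1 hxP).1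
    refine Finset.disjoint_left.1 (hsep u (Finset.mem_union_right _ hu) q
      (Finset.mem_union_left _ hq) ?_) hx hxq
    rintro rfl
    exact Finset.disjoint_left.1 hQU hq hu
  have hP₁U : Disjoint P₁ U' := by
    rw [Finset.disjoint_right]
    intro u hu huP
    have := hUP u (hU'U hu)
    exact Finset.notMem_empty u (this ▸ Finset.mem_inter.2 ⟨hself u, huP⟩)
  have hf₂ := hf₁.union hN hP₁U hg
    (fun u hu => (Finset.mem_sdiff.1 (Finset.mem_filter.1 (hgU u hu)).1).2)
    (fun u hu v hv => hsep' u (Finset.mem_union_right _ (hU'U hu)) v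
      (Finset.mem_union_right _ (hU'U hv)))
    (by
      intro u hu h
      rw [hUP u (hU'U hu), Finset.image_empty] at h
      obtain ⟨-, b, hb, -, hbs⟩ := Finset.mem_filter.1 h
      have h1 := Finset.card_le_card hbs
      have h2 := hB b hb
      simp at h1
      omega)
  -- fill everything but the holes
  have hPUQ : P₁ ∪ U' ⊆ Finset.univ \ Q := by
    intro x hx
    rw [Finset.mem_sdiff]
    refine ⟨Finset.mem_univ _, fun hxQ => ?_⟩
    rcases Finset.mem_union.1 hx with h | h
    · exact Finset.disjoint_left.1 hP₁Q h hxQ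
    · exact Finset.disjoint_left.1 hQU hxQ (hU'U h)
  obtain ⟨f₃, hf₃, hf₃₂⟩ := hf₂.extend hN hD ((Finset.univ \ Q) \ (P₁ ∪ U'))
    Finset.disjoint_sdiff
    (by
      rw [Finset.union_sdiff_of_subset hPUQ]
      have := hn _ (Finset.sdiff_disjoint (s := Q) (t := Finset.univ))
      omega)
  rw [Finset.union_sdiff_of_subset hPUQ] at hf₃
  have hf₃₁ : ∀ p ∈ P₁, f₃ p = f₁ p := by
    intro p hp
    rw [hf₃₂ p (Finset.mem_union_left _ hp), if_neg (Finset.disjoint_left.1 hP₁U hp)]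
  have hbad₃ : ∀ q ∈ Q,
      completingPoints B ((N q ∩ (Finset.univ \ Q)).image f₃) = bad q := by
    intro q hq
    rw [hNQ q hq _ (Finset.union_subset_left hPUQ) Finset.sdiff_disjoint, hbad]
    congr 1
    exact Finset.image_congr fun x hx => hf₃₁ x (Finset.mem_inter.1 hx).2
  -- match the remaining points with the holes
  set R := Finset.univ \ (Finset.univ \ Q).image f₃ with hR
  have hRcard : R.card = 2 * D := by
    have h1 := Finset.card_sdiff_add_card_eq_card (Finset.subset_univ ((Finset.univ \ Q).image f₃))
    have h2 := Finset.card_sdiff_add_card_eq_card (Finset.subset_univ Q)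
    rw [Finset.card_image_of_injOn hf₃.1, Finset.card_univ] at h1
    rw [Finset.card_univ] at h2
    rw [hR]
    omega
  have hReasy : ∀ z ∈ R, (Q.filter fun q => z ∈ bad q).card ≤ D := by
    intro z hz
    by_contra! hlt
    have hz' := (Finset.mem_sdiff.1 hz).2
    have hzh : z ∈ hard := by
      refine Finset.mem_filter.2 ⟨Finset.mem_sdiff.2 ⟨Finset.mem_univ _, fun h => hz' ?_⟩, hlt⟩
      obtain ⟨p, hp, rfl⟩ := Finset.mem_image.1 h
      exact Finset.mem_image.2 ⟨p, hPUQ (Finset.mem_union_left _ hp), hf₃₁ p hp⟩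
    rw [← hgimg] at hzh
    obtain ⟨u, hu, rfl⟩ := Finset.mem_image.1 hzh
    refine hz' (Finset.mem_image.2 ⟨u, hPUQ (Finset.mem_union_right _ hu), ?_⟩)
    rw [hf₃₂ u (Finset.mem_union_right _ hu), if_pos hu]
  obtain ⟨m, hm, hmR⟩ : ∃ m : Q → V, Function.Injective m ∧ ∀ q : Q, m q ∈ R \ bad q := by
    rw [← Finset.all_card_le_biUnion_card_iff_exists_injective (fun q : Q => R \ bad q)]
    intro A
    rcases A.eq_empty_or_nonempty with rfl | ⟨q, hq⟩
    · simp
    by_cases hA : A.card ≤ D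
    · have h1 := Finset.card_le_card (Finset.subset_biUnion_of_mem (fun q : Q => R \ bad q) hq)
      have h2 := Finset.le_card_sdiff (bad q) R
      have h3 : (bad q).card ≤ D := hD _ _ _
      omega
    · have hsub : R ⊆ A.biUnion fun q : Q => R \ bad q := by
        intro z hz
        by_contra hcon
        simp only [Finset.mem_biUnion, Finset.mem_sdiff, not_exists, not_and, not_not] at hcon
        have h1 : A.map (Function.Embedding.subtype _) ⊆ Q.filter fun q => z ∈ bad q := by
          intro x hx
          obtain ⟨y, hy, rfl⟩ := Finset.mem_map.1 hx
          exact Finset.mem_filter.2 ⟨y.2, hcon y hy hz⟩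
        have h2 := Finset.card_le_card h1
        rw [Finset.card_map] at h2
        have h3 := hReasy z hz
        omega
      have h1 := Finset.card_le_card hsub
      have h2 : A.card ≤ Q.card := by simpa using Finset.card_le_univ A
      omega
  have hf₄ := hf₃.union (U := Q) (g := fun x => if h : x ∈ Q then m ⟨x, h⟩ else f₃ x) hN
    Finset.sdiff_disjoint
    (by
      intro x hx y hy hxy
      rw [Finset.mem_coe] at hx hy
      simpa [hx, hy, hm.eq_iff] using hxy)
    (by
      intro u hu
      have := hmR ⟨u, hu⟩
      rw [Finset.mem_sdiff, hR, Finset.mem_sdiff] at this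
      simpa only [hu, dif_pos] using this.1.2)
    (fun u hu v hv => hsep' u (Finset.mem_union_left _ hu) v (Finset.mem_union_left _ hv))
    (by
      intro u hu
      have := (Finset.mem_sdiff.1 (hmR ⟨u, hu⟩)).2
      rw [hbad₃ u hu]
      simpa only [hu, dif_pos] using this)
  rw [Finset.sdiff_union_of_subset (Finset.subset_univ Q)] at hf₄
  refine ⟨_, fun x y h => hf₄.1 (by simp) (by simp) h, fun i b hb => ?_⟩
  simpa only [Finset.inter_univ] using hf₄.2 i b hb

end Assignment

/-- In a design, few points complete a block with a given set of points. -/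
theorem card_completingPoints_le {V : Type*} [Fintype V] [DecidableEq V] {t k lam : ℕ}
    (htk : t < k) {B : Finset (Finset V)} (hB : ∀ b ∈ B, b.card = k)
    (hdes : ∀ T : Finset V, T.card = t → (B.filter (fun b => T ⊆ b)).card = lam)
    (S : Finset V) :
    (completingPoints B S).card ≤ S.card ^ t * (lam * k) := by
  have hsub : completingPoints B S ⊆
      (S.powersetCard t).biUnion fun T => (B.filter fun b => T ⊆ b).biUnion id := by
    intro z hz
    obtain ⟨-, b, hb, hzb, hbs⟩ := Finset.mem_filter.1 hz
    have h1 : t ≤ (b.erase z).card := by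
      rw [Finset.card_erase_of_mem hzb, hB b hb]
      omega
    obtain ⟨T, hT, hTc⟩ := Finset.exists_subset_card_eq h1
    simp only [Finset.mem_biUnion, Finset.mem_powersetCard, Finset.mem_filter, id]
    exact ⟨T, ⟨hT.trans (Finset.subset_insert_iff.1 hbs), hTc⟩, b,
      ⟨hb, hT.trans (Finset.erase_subset _ _)⟩, hzb⟩
  refine (Finset.card_le_card hsub).trans ?_
  refine (Finset.card_biUnion_le_card_mul _ _ (lam * k) fun T hT => ?_).trans
    (Nat.mul_le_mul_right _ ?_)
  · rw [← hdes T (Finset.mem_powersetCard.1 hT).2]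
    exact Finset.card_biUnion_le_card_mul _ _ _ fun b hb => (hB b (Finset.mem_filter.1 hb).1).le
  · rw [Finset.card_powersetCard]
    exact Nat.choose_le_pow _ _

/-- Positions on a cycle of length `n ≥ 2 * ℓ * K` that are multiples of `2 * ℓ` have disjoint
neighbourhoods of radius `ℓ`. -/
theorem ZMod.disjoint_neighbourhoods {n ℓ K a b : ℕ} (hn : 2 * ℓ * K ≤ n) (ha : a < K)
    (hb : b < K) (hab : a ≠ b) :
    Disjoint
      ((Finset.range (2 * ℓ)).image fun j : ℕ => ((2 * ℓ * a : ℕ) : ZMod n) - ℓ + j)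
      ((Finset.range (2 * ℓ)).image fun j : ℕ => ((2 * ℓ * b : ℕ) : ZMod n) - ℓ + j) := by
  have lt : ∀ c < K, ∀ j < 2 * ℓ, 2 * ℓ * c + j < n := by
    intro c hc j hj
    have : 2 * ℓ * (c + 1) ≤ 2 * ℓ * K := Nat.mul_le_mul_left _ hc
    rw [mul_add] at this
    omega
  rw [Finset.disjoint_left]
  intro x hx hx'
  simp only [Finset.mem_image, Finset.mem_range] at hx hx'
  obtain ⟨i, hi, rfl⟩ := hx
  obtain ⟨j, hj, hij⟩ := hx'
  have h : ((2 * ℓ * b + j : ℕ) : ZMod n) = ((2 * ℓ * a + i : ℕ) : ZMod n) := by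
    rw [Nat.cast_add, Nat.cast_add]
    linear_combination hij
  rw [ZMod.natCast_eq_natCast_iff', Nat.mod_eq_of_lt (lt b hb j hj),
    Nat.mod_eq_of_lt (lt a ha i hi)] at h
  have h' := congrArg (· / (2 * ℓ)) h
  simp only [Nat.mul_add_div (by omega : 0 < 2 * ℓ), Nat.div_eq_of_lt hi,
    Nat.div_eq_of_lt hj, add_zero] at h'
  exact hab h'.symm


/-- for fixed `2 ≤ t < k` and `λ ≥ 1` there is a constant
`C > 0` such that every design `S_λ(t,k,n)` with `n ≥ C·ℓ^(2t)` has a cyclic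
`ℓ`-good sequencing (for every `ℓ ≥ k`). -/
theorem stmt_11 (t k lam : ℕ) (ht : 2 ≤ t) (htk : t < k) (hlam : 1 ≤ lam) :
    ∃ C : ℝ, 0 < C ∧ ∀ (ℓ n : ℕ), k ≤ ℓ →
      (n : ℝ) ≥ C * (ℓ : ℝ) ^ (2 * t) →
      ∀ (V : Type) [Fintype V] [DecidableEq V], Fintype.card V = n →
      ∀ B : Finset (Finset V),
        (∀ b ∈ B, b.card = k) →
        (∀ T : Finset V, T.card = t → (B.filter (fun b => T ⊆ b)).card = lam) →
        ∃ xs : List V, xs.Nodup ∧ (∀ v : V, v ∈ xs) ∧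
          ∀ i m : ℕ, m ≤ ℓ → m ≤ xs.length →
            ∀ b ∈ B, ¬ (∀ v ∈ b, v ∈ (xs.rotate i).take m) := by
  have hk : 0 < k := by omega
  refine ⟨8 * (2 ^ t * (lam * k) : ℕ), by positivity, ?_⟩
  intro ℓ n hkl hn V _ _ hV B hB hdes
  have hl : 0 < ℓ := by omega
  set D := (2 * ℓ) ^ t * (lam * k) with hDdef
  have hnD : 2 * ℓ * (4 * D) ≤ n := by
    have h1 : 8 * (2 ^ t * (lam * k)) * ℓ ^ (2 * t) ≤ n := by exact_mod_cast hn
    refine le_trans ?_ h1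
    have h2 : ℓ ^ (t + 1) ≤ ℓ ^ (2 * t) := Nat.pow_le_pow_right hl (by omega)
    calc 2 * ℓ * (4 * D) = 8 * (2 ^ t * (lam * k)) * ℓ ^ (t + 1) := by
          rw [hDdef, mul_pow]; ring
      _ ≤ _ := Nat.mul_le_mul_left _ h2
  have hDpos : 0 < D := by positivity
  have hnpos : 0 < n := lt_of_lt_of_le (by positivity) hnD
  have : NeZero n := ⟨hnpos.ne'⟩
  set N : ZMod n → Finset (ZMod n) := fun p =>
    (Finset.range (2 * ℓ)).image fun j : ℕ => p - ℓ + j with hNdef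
  set c : ℕ → ZMod n := fun j => ((2 * ℓ * j : ℕ) : ZMod n) with hc
  have hself : ∀ p, p ∈ N p := fun p =>
    Finset.mem_image.2 ⟨ℓ, Finset.mem_range.2 (by omega), by simp⟩
  have hdisj : ∀ a < 4 * D, ∀ b < 4 * D, a ≠ b → Disjoint (N (c a)) (N (c b)) :=
    fun a ha b hb hab => ZMod.disjoint_neighbourhoods hnD ha hb hab
  have hinj : ∀ a < 4 * D, ∀ b < 4 * D, c a = c b → a = b := by
    intro a ha b hb h
    by_contra hab
    exact Finset.disjoint_left.1 (hdisj a ha b hb hab) (hself _) (h ▸ hself _)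
  obtain ⟨f, hf, hfB⟩ := exists_injective_avoiding (α := ZMod n) (V := V) (ι := ZMod n)
    (W := fun i => (Finset.range ℓ).image fun j : ℕ => i + j) (B := B) (N := N) (D := D)
    (by rw [ZMod.card, hV])
    (fun b hb => by rw [hB b hb]; omega)
    (by
      intro i p hp x hx
      simp only [Finset.mem_image, Finset.mem_range] at hp hx
      obtain ⟨j, hj, rfl⟩ := hp
      obtain ⟨j', hj', rfl⟩ := hx
      refine Finset.mem_image.2 ⟨ℓ - j + j', Finset.mem_range.2 (by omega), ?_⟩
      rw [Nat.cast_add, Nat.cast_sub hj.le]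
      ring)
    hself
    (by
      intro p P f
      refine (card_completingPoints_le htk hB hdes _).trans
        (Nat.mul_le_mul_right _ (Nat.pow_le_pow_left ?_ _))
      refine Finset.card_image_le.trans ((Finset.card_le_card Finset.inter_subset_left).trans ?_)
      exact Finset.card_image_le.trans (Finset.card_range _).le)
    ((Finset.Ico 0 (2 * D)).image c) ((Finset.Ico (2 * D) (4 * D)).image c)
    (by
      rw [Finset.card_image_of_injOn, Nat.card_Ico, Nat.sub_zero]
      intro a ha b hb
      simp only [Finset.coe_Ico, Set.mem_Ico] at ha hb
      exact hinj a (by omega) b (by omega))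
    (by
      rw [Finset.card_image_of_injOn, Nat.card_Ico]
      · omega
      intro a ha b hb
      simp only [Finset.coe_Ico, Set.mem_Ico] at ha hb
      exact hinj a (by omega) b (by omega))
    (by
      rw [Finset.disjoint_left]
      intro x hx hx'
      simp only [Finset.mem_image, Finset.mem_Ico] at hx hx'
      obtain ⟨a, ha, rfl⟩ := hx
      obtain ⟨b, hb, hab⟩ := hx'
      have := hinj b (by omega) a (by omega) hab
      omega)
    (by
      rw [← Finset.image_union, Finset.Ico_union_Ico_eq_Ico (by omega) (by omega)]
      intro p hp q hq hpq
      simp only [Finset.mem_image, Finset.mem_Ico] at hp hq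
      obtain ⟨a, ha, rfl⟩ := hp
      obtain ⟨b, hb, rfl⟩ := hq
      exact hdisj a ha.2 b hb.2 fun h => hpq (h ▸ rfl))
  have hbij : Function.Bijective f :=
    (Fintype.bijective_iff_injective_and_card f).2 ⟨hf, by rw [ZMod.card, hV]⟩
  refine ⟨(List.range n).map fun j : ℕ => f j, ?_, ?_, ?_⟩
  · refine List.Nodup.map_on (fun a ha b hb hab => ?_) List.nodup_range
    have := hf hab
    rwa [ZMod.natCast_eq_natCast_iff', Nat.mod_eq_of_lt (List.mem_range.1 ha),
      Nat.mod_eq_of_lt (List.mem_range.1 hb)] at this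
  · intro v
    obtain ⟨x, rfl⟩ := hbij.2 v
    exact List.mem_map.2 ⟨x.val, List.mem_range.2 x.val_lt, by simp⟩
  · intro i m hm _ b hb hall
    refine hfB (i : ZMod n) b hb fun v hv => ?_
    obtain ⟨j, hj, rfl⟩ := List.mem_iff_getElem.1 (hall v hv)
    rw [List.length_take] at hj
    refine Finset.mem_image.2 ⟨i + j, Finset.mem_image.2 ⟨j, Finset.mem_range.2 (by omega), rfl⟩, ?_⟩
    simp [List.getElem_rotate, add_comm]
end

section
/- Let m be a positive integer with m ≡ 2 (mod 4), and set n = 6m + 1. Then there exists a Steiner triple system on n points which has a cyclic ((n+3)/4)-good sequencing (note (n+3)/4 = (3m+2)/2 is an integer). -/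
/-- The third point of the `r`-th base block `{0, r, hookedSum s r}`, for `1 ≤ r ≤ 4 * s + 2`. It is
`4 * s + 2` plus the position of the second occurrence of `r` in a hooked Skolem sequence of order
`4 * s + 2`. -/
def hookedSum (s r : ℕ) : ℕ :=
  if r % 2 = 0 then
    if r = 4 * s + 2 then 12 * s + 7 else 6 * s + 3 + r / 2
  else if r = 4 * s + 1 then 10 * s + 4
  else if r = 1 then 11 * s + 6
  else if r = 2 * s + 1 then 10 * s + 5
  else if r < 2 * s + 1 then 10 * s + 5 + r / 2
  else 10 * s + 6 + r / 2

lemma hookedSum_bounds {s r : ℕ} (h1 : 1 ≤ r) (h2 : r ≤ 4 * s + 2) :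
    6 * s + 4 ≤ hookedSum s r ∧ 4 * s + 2 + r < hookedSum s r ∧ hookedSum s r ≤ 12 * s + 7 ∧
      hookedSum s r ≠ 12 * s + 6 ∧ hookedSum s r < 12 * s + 6 + r := by
  unfold hookedSum
  split_ifs <;> omega

lemma hookedSum_inj {s r r' : ℕ} (h1 : 1 ≤ r) (h2 : r ≤ 4 * s + 2) (h1' : 1 ≤ r')
    (h2' : r' ≤ 4 * s + 2) (h : hookedSum s r = hookedSum s r') : r = r' := by
  unfold hookedSum at h
  split_ifs at h <;> omega

lemma hookedSum_sub_inj {s r r' : ℕ} (h1 : 1 ≤ r) (h2 : r ≤ 4 * s + 2) (h1' : 1 ≤ r')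
    (h2' : r' ≤ 4 * s + 2) (h : hookedSum s r + r' = hookedSum s r' + r) : r = r' := by
  unfold hookedSum at h
  split_ifs at h <;> omega

lemma hookedSum_ne_sub {s r r' : ℕ} (h1 : 1 ≤ r) (h2 : r ≤ 4 * s + 2) (h1' : 1 ≤ r')
    (h2' : r' ≤ 4 * s + 2) : hookedSum s r + r' ≠ hookedSum s r' := by
  unfold hookedSum
  split_ifs <;> omega

lemma ZMod.natCast_eq_natCast_of_lt_two_mul {n a b : ℕ} (h : (a : ZMod n) = b) (ha : a < 2 * n)
    (hb : b < 2 * n) : a = b ∨ a = b + n ∨ b = a + n := by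
  have h' : a % n = b % n := (ZMod.natCast_eq_natCast_iff a b n).1 h
  have hn : 0 < n := by omega
  have hda := Nat.div_add_mod a n
  have hdb := Nat.div_add_mod b n
  have hqa : a / n < 2 := Nat.div_lt_of_lt_mul (by omega)
  have hqb : b / n < 2 := Nat.div_lt_of_lt_mul (by omega)
  interval_cases a / n <;> interval_cases b / n <;> omega

/-- The points of the base blocks, with blocks indexed from zero. -/
def basePoint (s : ℕ) (r : Fin (4 * s + 2)) (i : Fin 3) : ℕ :=
  ![0, r.1 + 1, hookedSum s (r.1 + 1)] i

lemma basePoint_difference_inj {s : ℕ} {r r' : Fin (4 * s + 2)} {i j i' j' : Fin 3} (hij : i ≠ j)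
    (hij' : i' ≠ j')
    (h : (basePoint s r j - basePoint s r i : ZMod (6 * (4 * s + 2) + 1)) =
      basePoint s r' j' - basePoint s r' i') : r = r' ∧ i = i' ∧ j = j' := by
  have h' : ((basePoint s r j + basePoint s r' i' : ℕ) : ZMod (6 * (4 * s + 2) + 1)) =
      (basePoint s r' j' + basePoint s r i : ℕ) := by
    push_cast
    linear_combination h
  have hr := hookedSum_bounds (s := s) (r := r.1 + 1) (by omega) (by omega)
  have hr' := hookedSum_bounds (s := s) (r := r'.1 + 1) (by omega) (by omega)
  have e1 := hookedSum_inj (s := s) (r := r.1 + 1) (r' := r'.1 + 1)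
    (by omega) (by omega) (by omega) (by omega)
  have e2 := hookedSum_sub_inj (s := s) (r := r.1 + 1) (r' := r'.1 + 1)
    (by omega) (by omega) (by omega) (by omega)
  have e3 := hookedSum_ne_sub (s := s) (r := r.1 + 1) (r' := r'.1 + 1)
    (by omega) (by omega) (by omega) (by omega)
  have e4 := hookedSum_ne_sub (s := s) (r := r'.1 + 1) (r' := r.1 + 1)
    (by omega) (by omega) (by omega) (by omega)
  have hb : ∀ (t : Fin (4 * s + 2)) k, basePoint s t k ≤ 12 * s + 7 := by
    intro t k
    have := hookedSum_bounds (s := s) (r := t.1 + 1) (by omega) (by omega)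
    fin_cases k <;> simp [basePoint] <;> omega
  have key := ZMod.natCast_eq_natCast_of_lt_two_mul h'
    (by have := hb r j; have := hb r' i'; omega) (by have := hb r' j'; have := hb r i; omega)
  rw [Fin.ext_iff]
  fin_cases i <;> fin_cases j <;> first | exact absurd rfl hij | skip
  all_goals
    fin_cases i' <;> fin_cases j' <;> first | exact absurd rfl hij' | skip
  all_goals
    simp [basePoint] at key ⊢
    omega

lemma exists_basePoint_difference {s : ℕ} {d : ZMod (6 * (4 * s + 2) + 1)} (hd : d ≠ 0) :
    ∃ r i j, i ≠ j ∧ (basePoint s r j - basePoint s r i : ZMod (6 * (4 * s + 2) + 1)) = d := by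
  let f : Fin (4 * s + 2) × {q : Fin 3 × Fin 3 // q.1 ≠ q.2} → ZMod (6 * (4 * s + 2) + 1) :=
    fun q => basePoint s q.1 q.2.1.2 - basePoint s q.1 q.2.1.1
  have hf : Function.Injective f := by
    rintro ⟨r, ⟨⟨i, j⟩, hij⟩⟩ ⟨r', ⟨⟨i', j'⟩, hij'⟩⟩ h
    obtain ⟨rfl, rfl, rfl⟩ := basePoint_difference_inj hij hij' h
    rfl
  have hf0 : ∀ q, f q ≠ 0 := by
    rintro ⟨r, ⟨⟨i, j⟩, hij⟩⟩ h
    have h0 : (basePoint s r j - basePoint s r i : ZMod (6 * (4 * s + 2) + 1)) = 0 := h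
    have h' : (basePoint s r j - basePoint s r i : ZMod (6 * (4 * s + 2) + 1)) =
        basePoint s r i - basePoint s r j := by
      linear_combination 2 * h0
    exact hij (basePoint_difference_inj hij hij.symm h').2.1
  have himg : Finset.univ.image f = Finset.univ.erase 0 := by
    apply Finset.eq_of_subset_of_card_le
    · intro x hx
      obtain ⟨q, -, rfl⟩ := Finset.mem_image.1 hx
      simp [hf0]
    · have h6 : Fintype.card {q : Fin 3 × Fin 3 // q.1 ≠ q.2} = 6 := by decide
      rw [Finset.card_image_of_injective _ hf, Finset.card_erase_of_mem (Finset.mem_univ _),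
        Finset.card_univ, Finset.card_univ, ZMod.card, Fintype.card_prod, h6, Fintype.card_fin]
      omega
  have hmem : d ∈ Finset.univ.image f := by simp [himg, hd]
  obtain ⟨⟨r, ⟨⟨i, j⟩, hij⟩⟩, -, h⟩ := Finset.mem_image.1 hmem
  exact ⟨r, i, j, hij, h⟩

/-- The translate by `z` of the `r`-th base block. -/
def translatedBlock (s : ℕ) (z : ZMod (6 * (4 * s + 2) + 1)) (r : Fin (4 * s + 2)) :
    Finset (ZMod (6 * (4 * s + 2) + 1)) :=
  Finset.univ.image fun i => z + basePoint s r i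

lemma mem_translatedBlock {s : ℕ} {z x : ZMod (6 * (4 * s + 2) + 1)} {r : Fin (4 * s + 2)} :
    x ∈ translatedBlock s z r ↔ ∃ i, z + basePoint s r i = x := by
  simp [translatedBlock]

lemma card_translatedBlock {s : ℕ} (z : ZMod (6 * (4 * s + 2) + 1)) (r : Fin (4 * s + 2)) :
    (translatedBlock s z r).card = 3 := by
  rw [translatedBlock, Finset.card_image_of_injective, Finset.card_univ, Fintype.card_fin]
  intro i j h
  dsimp only at h
  by_contra hij
  have h' : (basePoint s r j - basePoint s r i : ZMod (6 * (4 * s + 2) + 1)) =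
      basePoint s r i - basePoint s r j := by
    linear_combination -2 * h
  exact hij (basePoint_difference_inj hij (Ne.symm hij) h').2.1

lemma existsUnique_translatedBlock {s : ℕ} {x y : ZMod (6 * (4 * s + 2) + 1)} (hxy : x ≠ y) :
    ∃! b, b ∈ {b | ∃ z r, b = translatedBlock s z r} ∧ x ∈ b ∧ y ∈ b := by
  obtain ⟨r, i, j, hij, h⟩ := exists_basePoint_difference (sub_ne_zero.2 hxy.symm)
  refine ⟨translatedBlock s (x - basePoint s r i) r, ⟨⟨_, _, rfl⟩,
    mem_translatedBlock.2 ⟨i, by ring⟩, mem_translatedBlock.2 ⟨j, by linear_combination h⟩⟩, ?_⟩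
  rintro _ ⟨⟨z, r', rfl⟩, hx, hy⟩
  obtain ⟨i', hi'⟩ := mem_translatedBlock.1 hx
  obtain ⟨j', hj'⟩ := mem_translatedBlock.1 hy
  have hij' : i' ≠ j' := by
    rintro rfl
    exact hxy (hi'.symm.trans hj')
  obtain ⟨rfl, rfl, rfl⟩ := basePoint_difference_inj hij hij'
    (h.trans (by linear_combination hi' - hj'))
  rw [← hi', add_sub_cancel_right]

lemma exists_eq_of_mem_take_rotate {n i l : ℕ} {v : ZMod n}
    (hv : v ∈ (((List.range n).map ((↑) : ℕ → ZMod n)).rotate i).take l) :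
    ∃ k < l, v = ((k + i : ℕ) : ZMod n) := by
  obtain ⟨k, hk, rfl⟩ := List.mem_iff_getElem.1 hv
  refine ⟨k, (List.length_take_le _ _).trans_lt' hk, ?_⟩
  simp [List.getElem_rotate]

lemma not_translatedBlock_subset_segment {s i l : ℕ} (hl : l ≤ 6 * s + 4)
    (z : ZMod (6 * (4 * s + 2) + 1)) (r : Fin (4 * s + 2)) :
    ¬ ∀ v ∈ translatedBlock s z r, v ∈ (((List.range (6 * (4 * s + 2) + 1)).map
      ((↑) : ℕ → ZMod (6 * (4 * s + 2) + 1))).rotate i).take l := by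
  intro h
  obtain ⟨k, hk, ek⟩ := exists_eq_of_mem_take_rotate (h _ (mem_translatedBlock.2 ⟨0, rfl⟩))
  obtain ⟨k', hk', ek'⟩ := exists_eq_of_mem_take_rotate (h _ (mem_translatedBlock.2 ⟨2, rfl⟩))
  have hr := hookedSum_bounds (s := s) (r := r.1 + 1) (by omega) (by omega)
  have e : ((k + hookedSum s (r.1 + 1) : ℕ) : ZMod (6 * (4 * s + 2) + 1)) = k' := by
    simp [basePoint] at ek ek' ⊢
    linear_combination ek' - ek
  have := ZMod.natCast_eq_natCast_of_lt_two_mul e (by omega) (by omega)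
  omega

/-- for `m ≡ 2 (mod 4)` there is a Steiner triple system on
`n = 6m+1` points with a cyclic `(n+3)/4`-good sequencing. -/
theorem stmt_12 (m : ℕ) (hm : 0 < m) (hm4 : m % 4 = 2) :
    ∃ B : Set (Finset (Fin (6 * m + 1))),
      (∀ b ∈ B, b.card = 3) ∧
      (∀ x y : Fin (6 * m + 1), x ≠ y → ∃! b, b ∈ B ∧ x ∈ b ∧ y ∈ b) ∧
      ∃ xs : List (Fin (6 * m + 1)), xs.Nodup ∧ (∀ v, v ∈ xs) ∧
        ∀ i m' : ℕ, m' ≤ (6 * m + 1 + 3) / 4 → m' ≤ xs.length →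
          ∀ b ∈ B, ¬ (∀ v ∈ b, v ∈ (xs.rotate i).take m') := by
  obtain ⟨s, rfl⟩ : ∃ s, m = 4 * s + 2 := ⟨m / 4, by omega⟩
  change ∃ B : Set (Finset (ZMod (6 * (4 * s + 2) + 1))),
      (∀ b ∈ B, b.card = 3) ∧
      (∀ x y : ZMod (6 * (4 * s + 2) + 1), x ≠ y → ∃! b, b ∈ B ∧ x ∈ b ∧ y ∈ b) ∧
      ∃ xs : List (ZMod (6 * (4 * s + 2) + 1)), xs.Nodup ∧ (∀ v, v ∈ xs) ∧
        ∀ i m' : ℕ, m' ≤ (6 * (4 * s + 2) + 1 + 3) / 4 → m' ≤ xs.length →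
          ∀ b ∈ B, ¬ (∀ v ∈ b, v ∈ (xs.rotate i).take m')
  refine ⟨{b | ∃ z r, b = translatedBlock s z r}, ?_, fun x y => existsUnique_translatedBlock,
    (List.range (6 * (4 * s + 2) + 1)).map (↑), ?_, ?_, ?_⟩
  · rintro _ ⟨z, r, rfl⟩
    exact card_translatedBlock z r
  · refine List.Nodup.map_on ?_ List.nodup_range
    intro a ha b hb h
    rw [List.mem_range] at ha hb
    have := ZMod.natCast_eq_natCast_of_lt_two_mul h (by omega) (by omega)
    omega
  · intro v
    exact List.mem_map.2 ⟨v.val, List.mem_range.2 (ZMod.val_lt v), ZMod.natCast_zmod_val v⟩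
  · rintro i l hl - _ ⟨z, r, rfl⟩
    exact not_translatedBlock_subset_segment (by omega) z r
end

section
/- Let m be a positive integer such that there exists a Steiner quadruple system on m points. Then there exists a Steiner quadruple system on n = 4m points which has a cyclic (m+1)-good sequencing (that is, a cyclic (n/4 + 1)-good sequencing). -/
/-- A family of four-element sets covers every triple exactly once if and only if every three
distinct points have exactly one fourth point completing them to a block. -/
theorem existsUnique_block_iff_existsUnique_point {P : Type*} [DecidableEq P]
    {B : Set (Finset P)} (hB : ∀ b ∈ B, b.card = 4) :
    (∀ T : Finset P, T.card = 3 → ∃! b, b ∈ B ∧ T ⊆ b) ↔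
      ∀ p q r : P, p ≠ q → p ≠ r → q ≠ r →
        ∃! s, s ∉ ({p, q, r} : Finset P) ∧ insert s {p, q, r} ∈ B := by
  have exists_insert : ∀ T : Finset P, T.card = 3 → ∀ b ∈ B, T ⊆ b →
      ∃ s, s ∉ T ∧ insert s T = b := by
    intro T hT b hb hTb
    refine Finset.exists_eq_insert_iff.2 ⟨hTb, ?_⟩
    rw [hT, hB b hb]
  constructor
  · intro h p q r hpq hpr hqr
    have hT : ({p, q, r} : Finset P).card = 3 := Finset.card_eq_three.2 ⟨p, q, r, hpq, hpr, hqr, rfl⟩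
    obtain ⟨b, ⟨hb, hTb⟩, hu⟩ := h _ hT
    obtain ⟨s, hs, rfl⟩ := exists_insert _ hT b hb hTb
    refine ⟨s, ⟨hs, hb⟩, fun t ⟨ht, htB⟩ => ?_⟩
    have := hu _ ⟨htB, Finset.subset_insert _ _⟩
    have ht' : t ∈ insert s ({p, q, r} : Finset P) := this ▸ Finset.mem_insert_self t _
    exact (Finset.mem_insert.1 ht').resolve_right ht
  · intro h T hT
    obtain ⟨p, q, r, hpq, hpr, hqr, rfl⟩ := Finset.card_eq_three.1 hT
    obtain ⟨s, ⟨hs, hsB⟩, hu⟩ := h p q r hpq hpr hqr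
    refine ⟨_, ⟨hsB, Finset.subset_insert _ _⟩, fun b ⟨hb, hTb⟩ => ?_⟩
    obtain ⟨t, ht, rfl⟩ := exists_insert _ hT b hb hTb
    rw [hu t ⟨ht, hb⟩]

/-- The blocks of the quadrupling of `B` on points `p` with coordinate `f p` and label `l p`:
transversals of blocks of `B` whose labels sum to `g`, and sets in which every coordinate is
repeated and whose labels sum to zero. -/
def quadrupledBlocks {P X K : Type*} [DecidableEq X] [AddCommGroup K]
    (B : Set (Finset X)) (f : P → X) (l : P → K) (g : K) : Set (Finset P) :=
  {b | b.card = 4 ∧ ((b.image f ∈ B ∧ ∑ p ∈ b, l p = g) ∨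
    ((∀ p ∈ b, ∃ q ∈ b, q ≠ p ∧ f q = f p) ∧ ∑ p ∈ b, l p = 0))}

theorem add_eq_iff_eq_add_of_add_self {K : Type*} [AddCommGroup K] (hK : ∀ a : K, a + a = 0)
    {a b c : K} : a + b = c ↔ a = c + b := by
  rw [← eq_sub_iff_add_eq, sub_eq_add_neg, neg_eq_of_add_eq_zero_left (hK b)]

theorem existsUnique_quadrupledBlocks {P X K : Type*} [DecidableEq P] [DecidableEq X]
    [AddCommGroup K] (hK : ∀ a : K, a + a = 0)
    {B : Set (Finset X)} (hB : ∀ b ∈ B, b.card = 4)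
    (hB' : ∀ T : Finset X, T.card = 3 → ∃! b, b ∈ B ∧ T ⊆ b)
    {f : P → X} {l : P → K} (hfl : Function.Bijective fun p => (f p, l p)) (g : K)
    (T : Finset P) (hT : T.card = 3) :
    ∃! b, b ∈ quadrupledBlocks B f l g ∧ T ⊆ b := by
  have inj : ∀ p q, f p = f q → l p = l q → p = q := fun p q h₁ h₂ =>
    hfl.1 (Prod.ext h₁ h₂)
  have surj : ∀ x a, ∃ p, f p = x ∧ l p = a := fun x a => by
    obtain ⟨p, hp⟩ := hfl.2 (x, a)
    exact ⟨p, congrArg Prod.fst hp, congrArg Prod.snd hp⟩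
  have sum_insert : ∀ p q r s : P, p ≠ q → p ≠ r → q ≠ r → s ∉ ({p, q, r} : Finset P) →
      ∑ x ∈ insert s ({p, q, r} : Finset P), l x = l s + (l p + l q + l r) := by
    intro p q r s hpq hpr hqr hs
    rw [Finset.sum_insert hs, Finset.sum_insert (by simp [hpq, hpr]), Finset.sum_pair hqr, add_assoc]
  have card_insert : ∀ p q r s : P, p ≠ q → p ≠ r → q ≠ r → s ∉ ({p, q, r} : Finset P) →
      (insert s ({p, q, r} : Finset P)).card = 4 := by
    intro p q r s hpq hpr hqr hs
    rw [Finset.card_insert_of_notMem hs, Finset.card_eq_three.2 ⟨p, q, r, hpq, hpr, hqr, rfl⟩]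
  -- three points, two of which share a coordinate
  have repeated : ∀ p q r : P, p ≠ q → p ≠ r → q ≠ r → f p = f q →
      ∃! s, s ∉ ({p, q, r} : Finset P) ∧ insert s {p, q, r} ∈ quadrupledBlocks B f l g := by
    intro p q r hpq hpr hqr hf
    obtain ⟨s, hsf, hsl⟩ := surj (f r) (l p + l q + l r)
    have hs : s ∉ ({p, q, r} : Finset P) := by
      simp only [Finset.mem_insert, Finset.mem_singleton, not_or]
      refine ⟨?_, ?_, ?_⟩
      · rintro rfl
        apply hqr
        refine inj _ _ (hf.symm.trans hsf) ?_
        rw [add_assoc, left_eq_add, add_eq_iff_eq_add_of_add_self hK, zero_add] at hsl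
        exact hsl
      · rintro rfl
        apply hpr
        refine inj _ _ (hf.trans hsf) ?_
        rw [add_right_comm, right_eq_add, add_eq_iff_eq_add_of_add_self hK, zero_add] at hsl
        exact hsl
      · rintro rfl
        apply hpq
        refine inj _ _ hf ?_
        rw [right_eq_add, add_eq_iff_eq_add_of_add_self hK, zero_add] at hsl
        exact hsl
    have hs' := hs
    simp only [Finset.mem_insert, Finset.mem_singleton, not_or] at hs'
    refine ⟨s, ⟨hs, card_insert p q r s hpq hpr hqr hs, Or.inr ⟨?_, ?_⟩⟩, ?_⟩
    · intro t ht
      simp only [Finset.mem_insert, Finset.mem_singleton] at ht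
      rcases ht with rfl | rfl | rfl | rfl
      · exact ⟨r, by simp, Ne.symm hs'.2.2, hsf.symm⟩
      · exact ⟨q, by simp, hpq.symm, hf.symm⟩
      · exact ⟨p, by simp, hpq, hf⟩
      · exact ⟨s, by simp, hs'.2.2, hsf⟩
    · rw [sum_insert p q r s hpq hpr hqr hs, hsl, hK]
    · rintro t ⟨ht, -, ⟨htB, -⟩ | ⟨htp, ht0⟩⟩
      · have h4 := hB _ htB
        have : (insert t ({p, q, r} : Finset P)).image f = {f t, f q, f r} := by
          simp [Finset.image_insert, hf]
        rw [this] at h4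
        have := Finset.card_le_three (a := f t) (b := f q) (c := f r)
        omega
      · rw [sum_insert p q r t hpq hpr hqr ht, add_eq_iff_eq_add_of_add_self hK, zero_add] at ht0
        refine inj _ _ ?_ (ht0.trans hsl.symm)
        rw [hsf]
        have h₁ := htp t (by simp)
        have h₂ := htp r (by simp)
        simp only [Finset.mem_insert, Finset.mem_singleton] at h₁ h₂
        grind
  rw [existsUnique_block_iff_existsUnique_point hB] at hB'
  refine (existsUnique_block_iff_existsUnique_point fun b hb => hb.1).2 ?_ T hT
  intro p q r hpq hpr hqr
  by_cases h₁ : f p = f q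
  · exact repeated p q r hpq hpr hqr h₁
  by_cases h₂ : f p = f r
  · have := repeated p r q hpr hpq hqr.symm h₂
    rwa [Finset.pair_comm] at this
  by_cases h₃ : f q = f r
  · have := repeated q r p hqr hpq.symm hpr.symm h₃
    have e : ({q, r, p} : Finset P) = {p, q, r} := by grind
    rwa [e] at this
  obtain ⟨w, ⟨hw, hwB⟩, hwu⟩ := hB' _ _ _ h₁ h₂ h₃
  obtain ⟨s, rfl, hsl⟩ := surj w (g + (l p + l q + l r))
  have hs : s ∉ ({p, q, r} : Finset P) := fun h => hw <| by
    have := Finset.mem_image_of_mem f h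
    simpa using this
  have himage : ∀ t, (insert t ({p, q, r} : Finset P)).image f = insert (f t) {f p, f q, f r} := by
    intro t
    simp [Finset.image_insert]
  refine ⟨s, ⟨hs, card_insert p q r s hpq hpr hqr hs, Or.inl ⟨?_, ?_⟩⟩, ?_⟩
  · rwa [himage]
  · rw [sum_insert p q r s hpq hpr hqr hs, add_eq_iff_eq_add_of_add_self hK, hsl]
  · rintro t ⟨ht, -, ⟨htB, htg⟩ | ⟨htp, -⟩⟩
    · rw [sum_insert p q r t hpq hpr hqr ht, add_eq_iff_eq_add_of_add_self hK] at htg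
      refine inj _ _ (hwu _ ⟨?_, himage t ▸ htB⟩) (htg.trans hsl.symm)
      intro hmem
      have h4 := hB _ htB
      rw [himage, Finset.insert_eq_of_mem hmem] at h4
      have := Finset.card_le_three (a := f p) (b := f q) (c := f r)
      omega
    · have hp := htp p (by simp)
      have hq := htp q (by simp)
      simp only [Finset.mem_insert, Finset.mem_singleton] at hp hq
      grind

/-- A set of points in two adjacent columns whose coordinates overlap in at most one place contains
no block of the quadrupling. -/
theorem not_subset_of_mem_quadrupledBlocks {P X K : Type*} [DecidableEq X] [PartialOrder X]
    [AddCommGroup K] (hK : ∀ a : K, a + a = 0)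
    {B : Set (Finset X)} {f : P → X} {l : P → K}
    (hfl : Function.Injective fun p => (f p, l p)) {g u v : K} (hg : g ≠ 0) (huv : u + v ≠ g)
    (x : X) {b : Finset P} (hb : b ∈ quadrupledBlocks B f l g)
    (hw : ∀ p ∈ b, (l p = u ∧ x ≤ f p) ∨ (l p = v ∧ f p ≤ x)) : False := by
  classical
  obtain ⟨h4, ⟨-, hsum⟩ | ⟨hp, -⟩⟩ := hb
  · obtain ⟨p, q, r, s, hpq, hpr, hps, hqr, hqs, hrs, rfl⟩ := Finset.card_eq_four.1 h4
    rw [Finset.sum_insert (by simp [hpq, hpr, hps]), Finset.sum_insert (by simp [hqr, hqs]),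
      Finset.sum_pair hrs] at hsum
    have key : ∀ t ∈ ({p, q, r, s} : Finset P), l t = u ∨ l t = v := fun t ht =>
      (hw t ht).imp And.left And.left
    have hu := hK u
    have hv := hK v
    rcases key p (by simp) with h₁ | h₁ <;> rcases key q (by simp) with h₂ | h₂ <;>
      rcases key r (by simp) with h₃ | h₃ <;> rcases key s (by simp) with h₄ | h₄ <;>
      rw [h₁, h₂, h₃, h₄] at hsum <;> grind
  · have hx : ∀ p ∈ b, f p = x := by
      intro p hpb
      obtain ⟨q, hqb, hne, hf⟩ := hp p hpb
      rcases hw p hpb with ⟨h₁, h₂⟩ | ⟨h₁, h₂⟩ <;> rcases hw q hqb with ⟨h₃, h₄⟩ | ⟨h₃, h₄⟩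
      · exact (hne (hfl (Prod.ext hf (h₃.trans h₁.symm)))).elim
      · exact le_antisymm (hf ▸ h₄) h₂
      · exact le_antisymm h₂ (hf ▸ h₄)
      · exact (hne (hfl (Prod.ext hf (h₃.trans h₁.symm)))).elim
    have hsub : b.image l ⊆ {u, v} := by
      intro a ha
      obtain ⟨p, hpb, rfl⟩ := Finset.mem_image.1 ha
      simpa using (hw p hpb).imp And.left And.left
    have hcard := Finset.card_le_card hsub
    rw [Finset.card_image_of_injOn fun p hpb q hqb h =>
      hfl (Prod.ext ((hx p hpb).trans (hx q hqb).symm) h)] at hcard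
    have := Finset.card_le_two (a := u) (b := v)
    omega

/-- The cyclic Gray code on two bits. -/
def grayCode : Fin 4 → ZMod 2 × ZMod 2 := ![(0, 0), (0, 1), (1, 1), (1, 0)]

theorem grayCode_bijective : Function.Bijective grayCode := by decide

theorem grayCode_add_succ (j : Fin 4) : grayCode j + grayCode (j + 1) ≠ (1, 1) := by
  revert j
  decide

/-- A cyclic window of length at most `m + 1` in `Fin (4 * m)` meets only two consecutive columns,
the first in a final segment and the second in an initial segment. -/
theorem exists_columns_of_window (m : ℕ) (hm : 0 < m) (i : ℕ) :
    ∃ (j : Fin 4) (x : Fin m), ∀ m' ≤ m + 1, ∀ p : Fin (4 * m),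
      p ∈ ((List.finRange (4 * m)).rotate i).take m' →
        (p.divNat = j ∧ x ≤ p.modNat) ∨ (p.divNat = j + 1 ∧ p.modNat ≤ x) := by
  have hlt : i % (4 * m) < 4 * m := Nat.mod_lt _ (by omega)
  refine ⟨Fin.divNat ⟨_, hlt⟩, Fin.modNat ⟨_, hlt⟩, fun m' hm' p hp => ?_⟩
  obtain ⟨k, hk, hkp⟩ := List.mem_iff_getElem.1 hp
  simp only [List.length_take, List.length_rotate, List.length_finRange] at hk
  rw [List.getElem_take, List.getElem_rotate, List.getElem_finRange] at hkp
  have hpv : (p : ℕ) = (k + i % (4 * m)) % (4 * m) := by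
    rw [← hkp]
    simp
  simp only [Fin.ext_iff, Fin.le_def, Fin.coe_divNat, Fin.coe_modNat, Fin.val_add, hpv]
  generalize i % (4 * m) = c at hlt
  have hkm : k ≤ m := by omega
  obtain ⟨r, j, hr, rfl⟩ : ∃ r j, r < m ∧ c = r + m * j :=
    ⟨c % m, c / m, Nat.mod_lt _ hm, (Nat.mod_add_div c m).symm⟩
  have hj : j < 4 := by
    by_contra! h
    have := Nat.mul_le_mul_left m h
    omega
  simp only [Nat.add_mul_div_left _ _ hm, Nat.add_mul_mod_self_left, Nat.div_eq_of_lt hr,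
    Nat.mod_eq_of_lt hr, Nat.mod_mul_left_mod, zero_add, Nat.mod_mul_left_div_self]
  rw [← add_assoc, Nat.add_mul_div_left _ _ hm, Nat.add_mul_mod_self_left]
  rcases lt_or_ge (k + r) m with h | h
  · left
    rw [Nat.div_eq_of_lt h, Nat.mod_eq_of_lt h]
    omega
  · right
    have hmod : (k + r) % m = k + r - m := by
      rw [Nat.mod_eq_sub_mod h, Nat.mod_eq_of_lt (by omega)]
    rw [Nat.div_eq_of_lt_le (k := 1) (by omega) (by omega), hmod]
    constructor
    · simp [add_comm]
    · omega

/-- if there is a Steiner quadruple system on `m` points, then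
there is a Steiner quadruple system on `n = 4m` points with a cyclic
`(m+1) = (n/4 + 1)`-good sequencing. -/
theorem stmt_14 (m : ℕ) (hm : 0 < m)
    (h : ∃ B : Set (Finset (Fin m)),
      (∀ b ∈ B, b.card = 4) ∧
      (∀ T : Finset (Fin m), T.card = 3 → ∃! b, b ∈ B ∧ T ⊆ b)) :
    ∃ B : Set (Finset (Fin (4 * m))),
      (∀ b ∈ B, b.card = 4) ∧
      (∀ T : Finset (Fin (4 * m)), T.card = 3 → ∃! b, b ∈ B ∧ T ⊆ b) ∧
      ∃ xs : List (Fin (4 * m)), xs.Nodup ∧ (∀ v, v ∈ xs) ∧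
        ∀ i m' : ℕ, m' ≤ m + 1 → m' ≤ xs.length →
          ∀ b ∈ B, ¬ (∀ v ∈ b, v ∈ (xs.rotate i).take m') := by
  obtain ⟨B, hB, hB'⟩ := h
  have hK : ∀ a : ZMod 2 × ZMod 2, a + a = 0 := by decide
  have hfl : Function.Bijective fun p : Fin (4 * m) => (p.modNat, grayCode p.divNat) :=
    (((finProdFinEquiv (m := 4) (n := m)).symm.trans (Equiv.prodComm _ _)).trans
      ((Equiv.refl _).prodCongr (Equiv.ofBijective _ grayCode_bijective))).bijective
  refine ⟨quadrupledBlocks B Fin.modNat (fun p => grayCode p.divNat) (1, 1), fun b hb => hb.1,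
    existsUnique_quadrupledBlocks hK hB hB' hfl _, List.finRange (4 * m),
    List.nodup_finRange _, List.mem_finRange, fun i m' hm' _ b hb hsub => ?_⟩
  obtain ⟨j, x, hjx⟩ := exists_columns_of_window m hm i
  refine not_subset_of_mem_quadrupledBlocks hK hfl.1 (by decide) (grayCode_add_succ j) x hb
    fun p hp => ?_
  exact (hjx m' hm' p (hsub p hp)).imp (And.imp_left (congrArg grayCode))
    (And.imp_left (congrArg grayCode))
end

section
/- There exist infinitely many positive integers m such that there is a Steiner quadruple system on n = 4m points having a cyclic (n/4 + 1)-good sequencing. -/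
/-- The 4-subsets of an elementary abelian 2-group which either sum to `u` or are invariant under
translation by `u`. For `u ≠ 0` they form a Steiner quadruple system. -/
def twistedBlocks {V : Type*} [AddCommGroup V] (u : V) : Set (Finset V) :=
  {b | b.card = 4 ∧ (∑ x ∈ b, x = u ∨ ∀ x ∈ b, x + u ∈ b)}

theorem existsUnique_mem_twistedBlocks {V : Type*} [AddCommGroup V]
    (h_two : ∀ x : V, x + x = 0) {u : V} (hu : u ≠ 0) (T : Finset V) (hT : T.card = 3) :
    ∃! b, b ∈ twistedBlocks u ∧ T ⊆ b := by
  classical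
  suffices h : ∃ w, w ∉ T ∧ insert w T ∈ twistedBlocks u ∧
      ∀ w', w' ∉ T → insert w' T ∈ twistedBlocks u → w' = w by
    obtain ⟨w, -, hw, huniq⟩ := h
    refine ⟨insert w T, ⟨hw, Finset.subset_insert _ _⟩, ?_⟩
    rintro b ⟨hb, hTb⟩
    obtain ⟨w', hw', rfl⟩ : ∃ w', w' ∉ T ∧ insert w' T = b :=
      (Finset.covBy_iff_exists_insert.1
        (Finset.covBy_iff_card_sdiff_eq_one.2 ⟨hTb, by
          rw [Finset.card_sdiff_of_subset hTb, hT, hb.1]⟩))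
    rw [huniq w' hw' hb]
  have mem_iff (w : V) (hw : w ∉ T) : insert w T ∈ twistedBlocks u ↔
      (w + ∑ x ∈ T, x = u ∨ ∀ x ∈ insert w T, x + u ∈ insert w T) := by
    simp [twistedBlocks, Finset.card_insert_of_notMem hw, hT, Finset.sum_insert hw]
  by_cases hpair : ∃ x ∈ T, x + u ∈ T
  · obtain ⟨x, hx, hxu⟩ := hpair
    have hne : x ≠ x + u := by simpa [eq_comm] using hu
    obtain ⟨z, hz⟩ : ∃ z, T \ {x, x + u} = {z} := by
      rw [← Finset.card_eq_one, Finset.card_sdiff_of_subset (by grind), hT,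
        Finset.card_pair hne]
    have hzT : z ∈ T ∧ z ≠ x ∧ z ≠ x + u := by
      have : z ∈ T \ {x, x + u} := by simp [hz]
      grind
    have hT' : T = {x, x + u, z} := by
      ext a
      have : a ∈ T \ {x, x + u} ↔ a ∈ ({z} : Finset V) := by rw [hz]
      grind
    have hxx := h_two x
    have huu := h_two u
    have hzz := h_two z
    have hw : z + u ∉ T := by
      simp only [hT', Finset.mem_insert, Finset.mem_singleton]
      clear hT' mem_iff hz h_two hT
      grind
    have hsum : ∑ a ∈ T, a = u + z := by
      rw [hT', Finset.sum_insert (by grind), Finset.sum_pair (by grind)]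
      grind
    refine ⟨z + u, hw, (mem_iff _ hw).2 (Or.inr ?_), fun w' hw' h => ?_⟩
    · have hzu : z + u + u = z := by rw [add_assoc, huu, add_zero]
      have hxu' : x + u + u = x := by rw [add_assoc, huu, add_zero]
      rw [hT']
      simp [hzu, hxu']
    · rcases (mem_iff _ hw').1 h with h | h
      · have hww := h_two w'
        have : w' + u = z + u := by
          rw [hsum] at h
          clear * - h hww hzz huu
          grind
        obtain rfl := add_right_cancel this
        exact absurd hzT.1 hw'
      · have := h z (by simp [hzT.1])
        grind
  · push Not at hpair
    obtain ⟨x, y, z, hxy, hxz, hyz, rfl⟩ := Finset.card_eq_three.1 hT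
    have hxx := h_two x
    have hyy := h_two y
    have hzz := h_two z
    have huu := h_two u
    have h1 := hpair x (by simp)
    have h2 := hpair y (by simp)
    have h3 := hpair z (by simp)
    have hsum : ∑ a ∈ ({x, y, z} : Finset V), a = x + y + z := by
      rw [Finset.sum_insert (by grind), Finset.sum_pair hyz, add_assoc]
    have hw : x + y + z + u ∉ ({x, y, z} : Finset V) := by
      simp only [Finset.mem_insert, Finset.mem_singleton] at h1 h2 h3 ⊢
      grind
    refine ⟨_, hw, (mem_iff _ hw).2 (Or.inl (by rw [hsum]; grind)), fun w' hw' h => ?_⟩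
    rcases (mem_iff _ hw').1 h with h | h
    · rw [hsum] at h
      grind
    · have := h x (by simp)
      have := h y (by simp)
      grind

/-- A block is not contained in a fibre of an additive character which is nontrivial at `u`. -/
theorem not_constant_on_twistedBlocks {V : Type*} [AddCommGroup V] {u : V}
    (φ : V →+ ZMod 2) (hφ : φ u = 1) {b : Finset V} (hb : b ∈ twistedBlocks u) (c : ZMod 2) :
    ¬ ∀ x ∈ b, φ x = c := by
  intro hc
  obtain ⟨hcard, hsum | hclosed⟩ := hb
  · have := congrArg φ hsum
    rw [map_sum, Finset.sum_congr rfl hc, Finset.sum_const, hcard, hφ] at this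
    have h_four : ∀ c : ZMod 2, 4 • c ≠ 1 := by decide
    exact h_four c this
  · obtain ⟨x, hx⟩ := Finset.card_pos.1 (by omega : 0 < b.card)
    have h := hc _ (hclosed x hx)
    rw [map_add, hc x hx, hφ] at h
    simp at h

/-- The quarters of `Fin (4 * 2 ^ j)`, of length `2 ^ j` each, are the fibres of the first two binary
coordinates. -/
theorem exists_binary_coordinates (j : ℕ) :
    ∃ E : Fin (4 * 2 ^ j) ≃ ZMod 2 × ZMod 2 × (Fin j → ZMod 2), ∀ v,
      (E v).1 = ((v.val / 2 ^ j / 2 : ℕ) : ZMod 2) ∧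
      (E v).2.1 = ((v.val / 2 ^ j : ℕ) : ZMod 2) := by
  let e₄ : Fin 4 ≃ ZMod 2 × ZMod 2 := (finProdFinEquiv (m := 2) (n := 2)).symm
  have he₄ : ∀ q : Fin 4, (e₄ q).1 = ((q.val / 2 : ℕ) : ZMod 2) ∧
      (e₄ q).2 = ((q.val : ℕ) : ZMod 2) := by decide
  let e : Fin (2 ^ j) ≃ (Fin j → ZMod 2) := (finFunctionFinEquiv (m := 2) (n := j)).symm
  refine ⟨finProdFinEquiv.symm.trans ((e₄.prodCongr e).trans (Equiv.prodAssoc _ _ _)),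
    fun v => ?_⟩
  exact he₄ v.divNat

/-- A cyclic segment of length at most `m + 1` meets at most two consecutive quarters. -/
theorem div_eq_of_mem_rotate_take {m i k : ℕ} (hk : k ≤ m + 1) {v : Fin (4 * m)}
    (hv : v ∈ ((List.finRange (4 * m)).rotate i).take k) :
    v.val / m = i % (4 * m) / m ∨ v.val / m = (i % (4 * m) / m + 1) % 4 := by
  have hm : 0 < m := by have := v.isLt; omega
  obtain ⟨p, hp, rfl⟩ := List.mem_iff_getElem.1 hv
  simp only [List.getElem_take, List.getElem_rotate, List.getElem_finRange, List.length_finRange,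
    Fin.val_cast]
  have hpk : p < k := by simp at hp; omega
  rw [← Nat.add_mod_mod]
  have hlt : i % (4 * m) < 4 * m := Nat.mod_lt _ (by omega)
  generalize i % (4 * m) = a at *
  have h1 := Nat.div_add_mod a m
  have h2 := Nat.mod_lt a hm
  have hq : a / m < 4 := Nat.div_lt_of_lt_mul (by rwa [mul_comm])
  generalize a / m = q at *
  by_cases hwrap : p + a < 4 * m
  · rw [Nat.mod_eq_of_lt hwrap, Nat.div_eq_iff hm, Nat.div_eq_iff hm]
    interval_cases q <;> omega
  · rw [Nat.mod_eq_sub_mod (by omega), Nat.mod_eq_of_lt (by omega), Nat.div_eq_iff hm,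
      Nat.div_eq_iff hm]
    interval_cases q <;> omega

/-- there are infinitely many positive integers `m` such that
some Steiner quadruple system on `n = 4m` points has a cyclic `(n/4+1)`-good
sequencing. -/
theorem stmt_15 :
    {m : ℕ | 0 < m ∧ ∃ B : Set (Finset (Fin (4 * m))),
      (∀ b ∈ B, b.card = 4) ∧
      (∀ T : Finset (Fin (4 * m)), T.card = 3 → ∃! b, b ∈ B ∧ T ⊆ b) ∧
      ∃ xs : List (Fin (4 * m)), xs.Nodup ∧ (∀ v, v ∈ xs) ∧
        ∀ i m' : ℕ, m' ≤ m + 1 → m' ≤ xs.length →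
          ∀ b ∈ B, ¬ (∀ v ∈ b, v ∈ (xs.rotate i).take m')}.Infinite := by
  refine Set.infinite_of_injective_forall_mem (Nat.pow_right_injective le_rfl) fun j => ?_
  refine ⟨by positivity, ?_⟩
  obtain ⟨E, hE⟩ := exists_binary_coordinates j
  set u : ZMod 2 × ZMod 2 × (Fin j → ZMod 2) := (1, 0, 0) with hu
  refine ⟨{b | b.map E.toEmbedding ∈ twistedBlocks u}, fun b hb => ?_, fun T hT => ?_,
    List.finRange _, List.nodup_finRange _, List.mem_finRange, fun i k hk _ b hb hwin => ?_⟩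
  · simpa using hb.1
  · have h_two : ∀ x : ZMod 2 × ZMod 2 × (Fin j → ZMod 2), x + x = 0 := by
      intro x
      ext <;> simp [CharTwo.add_self_eq_zero]
    have := existsUnique_mem_twistedBlocks h_two (u := u) (by simp [hu]) (T.map E.toEmbedding)
      (by simpa using hT)
    have h := (E.finsetCongr.bijective.existsUnique_iff
      (p := fun b => b ∈ twistedBlocks u ∧ T.map E.toEmbedding ⊆ b)).1 this
    simpa using h
  · have hwin' := fun v hv => div_eq_of_mem_rotate_take hk (hwin v hv)
    have hq : i % (4 * 2 ^ j) / 2 ^ j < 4 :=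
      Nat.div_lt_of_lt_mul (by rw [mul_comm]; exact Nat.mod_lt _ (by positivity))
    generalize i % (4 * 2 ^ j) / 2 ^ j = q at *
    let φ : ZMod 2 × ZMod 2 × (Fin j → ZMod 2) →+ ZMod 2 := AddMonoidHom.fst _ _
    let ψ : ZMod 2 × ZMod 2 × (Fin j → ZMod 2) →+ ZMod 2 :=
      φ + (AddMonoidHom.fst _ _).comp (AddMonoidHom.snd _ _)
    have hφ : φ u = 1 := rfl
    have hψ : ψ u = 1 := rfl
    have hφE (v) : φ (E v) = ((v.val / 2 ^ j / 2 : ℕ) : ZMod 2) := (hE v).1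
    have hψE (v) : ψ (E v) = ((v.val / 2 ^ j / 2 : ℕ) : ZMod 2) + ((v.val / 2 ^ j : ℕ) : ZMod 2) :=
      congrArg₂ (· + ·) (hE v).1 (hE v).2
    interval_cases q
    · refine not_constant_on_twistedBlocks φ hφ hb 0 (by
        simp only [Finset.forall_mem_map, Equiv.coe_toEmbedding, hφE]
        intro v hv
        rcases hwin' v hv with h | h <;> rw [h] <;> decide)
    · refine not_constant_on_twistedBlocks ψ hψ hb 1 (by
        simp only [Finset.forall_mem_map, Equiv.coe_toEmbedding, hψE]
        intro v hv
        rcases hwin' v hv with h | h <;> rw [h] <;> decide)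
    · refine not_constant_on_twistedBlocks φ hφ hb 1 (by
        simp only [Finset.forall_mem_map, Equiv.coe_toEmbedding, hφE]
        intro v hv
        rcases hwin' v hv with h | h <;> rw [h] <;> decide)
    · refine not_constant_on_twistedBlocks ψ hψ hb 0 (by
        simp only [Finset.forall_mem_map, Equiv.coe_toEmbedding, hψE]
        intro v hv
        rcases hwin' v hv with h | h <;> rw [h] <;> decide)
end

section
/- Let α be a real number with 0 < α < 1. Suppose that there exist infinitely many positive integers n for which there is a Steiner quadruple system on n points having a ⌊α·n⌋-good sequencing. Then α ≤ 1/√6. -/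
/-! Weights on triples of cells, certifying the bound. The points of the sequencing are grouped
into nine consecutive cells of relative sizes `10, 1, 10, 1, 10, 1, 10, 1, 10`; the weights of the
four triples inside a quadruple of cells spanning at least five cells add up to at least `8`,
although the average weight of a triple is less than `2`. -/

/-- The digits of the increasing rearrangement of a triple, read as a decimal number. -/
def sortedCode (i j k : ℕ) : ℕ :=
  100 * min i (min j k) + 10 * (i + j + k - min i (min j k) - max i (max j k)) + max i (max j k)

/-- The weight of a triple of cells, given by exceptions from the default value `2`, up to
reordering and reflection. -/
def tripleWeight (i j k : Fin 9) : ℕ :=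
  let c := min (sortedCode i j k) (sortedCode (8 - i) (8 - j) (8 - k))
  if c ∈ [113, 123, 133, 223, 233, 334, 344, 345] then 0
  else if c ∈ [13, 23, 245] then 1
  else if c ∈ [34, 45, 56, 57, 135, 136, 137, 145, 156, 235, 236] then 3
  else 2

/-- The relative size of a cell. -/
def cellWidth (i : Fin 9) : ℕ := if (i : ℕ) % 2 = 0 then 10 else 1

/-- The cell containing the `q`-th of `54` equal parts. -/
def cellIndex (q : ℕ) : ℕ := 2 * (q / 11) + q % 11 / 10

theorem eight_le_tripleWeight_sum : ∀ i j k l : Fin 9,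
    max (max (i : ℕ) j) (max (k : ℕ) l) ≤ min (min (i : ℕ) j) (min (k : ℕ) l) + 3 ∨
    8 ≤ tripleWeight i j k + tripleWeight i j l + tripleWeight i l k + tripleWeight l j k := by
  decide +kernel

theorem sum_tripleWeight :
    ∑ i, cellWidth i * ∑ j, cellWidth j * ∑ k, cellWidth k * tripleWeight i j k = 314808 := by
  decide +kernel

/-- The elements of each cell are few when `pos` enumerates `V` injectively. -/
theorem card_cell_le {V : Type*} [Fintype V] {n : ℕ} (hn : 0 < n) (pos : V → ℕ)
    (hpos : Function.Injective pos) (cell : V → Fin 9)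
    (hcell : ∀ v, (cell v : ℕ) = cellIndex (54 * pos v / n)) (i : Fin 9) :
    54 * (Finset.univ.filter fun v => cell v = i).card ≤ (n + 54) * cellWidth i := by
  have key : ∀ a w : ℕ,
      (∀ v, cell v = i → a ≤ 54 * pos v / n ∧ 54 * pos v / n < a + w) →
      54 * (Finset.univ.filter fun v => cell v = i).card ≤ n * w + 53 := by
    intro a w h
    have hcard : (Finset.univ.filter fun v => cell v = i).card ≤
        (Finset.Ico ((a * n + 53) / 54) (((a + w) * n + 53) / 54)).card := by
      refine Finset.card_le_card_of_injOn pos ?_ hpos.injOn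
      intro v hv
      obtain ⟨h1, h2⟩ := h v (by simpa using hv)
      rw [Nat.le_div_iff_mul_le hn] at h1
      rw [Nat.div_lt_iff_lt_mul hn] at h2
      simp only [Finset.coe_Ico, Set.mem_Ico]
      omega
    rw [Nat.card_Ico] at hcard
    have : (a + w) * n = a * n + n * w := by ring
    omega
  have hv : ∀ v, cell v = i → (i : ℕ) = cellIndex (54 * pos v / n) := by
    rintro v rfl
    exact hcell v
  have hlt := i.isLt
  unfold cellIndex at hv
  have hw := key (11 * (i / 2) + 10 * (i % 2)) (cellWidth i) fun v h => by
    have := hv v h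
    unfold cellWidth
    split_ifs <;> omega
  have : 1 ≤ cellWidth i := by unfold cellWidth; split_ifs <;> omega
  nlinarith

theorem sum_comp_le_of_card_fiber_le {V ι : Type*} [Fintype V] [Fintype ι] [DecidableEq ι]
    {a b : ℕ} (cell : V → ι) (w g : ι → ℕ)
    (h : ∀ i, a * (Finset.univ.filter fun v => cell v = i).card ≤ b * w i) :
    a * ∑ v, g (cell v) ≤ b * ∑ i, w i * g i := by
  rw [← Finset.sum_fiberwise' Finset.univ cell g, Finset.mul_sum, Finset.mul_sum]
  refine Finset.sum_le_sum fun i _ => ?_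
  rw [Finset.sum_const, smul_eq_mul, ← mul_assoc, ← mul_assoc]
  exact Nat.mul_le_mul_right _ (h i)

theorem sum_triple_comp_le_of_card_fiber_le {V ι : Type*} [Fintype V] [Fintype ι] [DecidableEq ι]
    {a b : ℕ} (cell : V → ι) (w : ι → ℕ) (g : ι → ι → ι → ℕ)
    (h : ∀ i, a * (Finset.univ.filter fun v => cell v = i).card ≤ b * w i) :
    a ^ 3 * ∑ x, ∑ y, ∑ z, g (cell x) (cell y) (cell z) ≤
      b ^ 3 * ∑ i, w i * ∑ j, w j * ∑ k, w k * g i j k := by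
  calc a ^ 3 * ∑ x, ∑ y, ∑ z, g (cell x) (cell y) (cell z)
      = a ^ 2 * ∑ x, ∑ y, a * ∑ z, g (cell x) (cell y) (cell z) := by
        simp only [← Finset.mul_sum]; ring
    _ ≤ a ^ 2 * ∑ x, ∑ y, b * ∑ k, w k * g (cell x) (cell y) k := by
        refine Nat.mul_le_mul_left _ (Finset.sum_le_sum fun x _ => Finset.sum_le_sum fun y _ => ?_)
        exact sum_comp_le_of_card_fiber_le cell w _ h
    _ = a * b * ∑ x, a * ∑ y, ∑ k, w k * g (cell x) (cell y) k := by
        simp only [← Finset.mul_sum]; ring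
    _ ≤ a * b * ∑ x, b * ∑ j, w j * ∑ k, w k * g (cell x) j k := by
        refine Nat.mul_le_mul_left _ (Finset.sum_le_sum fun x _ => ?_)
        exact sum_comp_le_of_card_fiber_le cell w (fun j => ∑ k, w k * g (cell x) j k) h
    _ = b ^ 2 * (a * ∑ x, ∑ j, w j * ∑ k, w k * g (cell x) j k) := by
        simp only [← Finset.mul_sum]; ring
    _ ≤ b ^ 2 * (b * ∑ i, w i * ∑ j, w j * ∑ k, w k * g i j k) := by
        refine Nat.mul_le_mul_left _ ?_
        exact sum_comp_le_of_card_fiber_le cell w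
          (fun i => ∑ j, w j * ∑ k, w k * g i j k) h
    _ = _ := by ring

/-- The ordered triples of distinct points. -/
def distinctTriples (V : Type*) [Fintype V] [DecidableEq V] : Finset (V × V × V) :=
  Finset.univ.filter fun t => t.1 ≠ t.2.1 ∧ t.1 ≠ t.2.2 ∧ t.2.1 ≠ t.2.2

@[simp]
theorem mem_distinctTriples {V : Type*} [Fintype V] [DecidableEq V] {x y z : V} :
    (x, y, z) ∈ distinctTriples V ↔ x ≠ y ∧ x ≠ z ∧ y ≠ z := by
  simp [distinctTriples]

theorem card_pow_three_le_card_distinctTriples {V : Type*} [Fintype V] [DecidableEq V] :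
    Fintype.card V ^ 3 ≤ (distinctTriples V).card + 3 * Fintype.card V ^ 2 := by
  let f₁ : V × V → V × V × V := fun p => (p.1, p.1, p.2)
  let f₂ : V × V → V × V × V := fun p => (p.1, p.2, p.1)
  let f₃ : V × V → V × V × V := fun p => (p.1, p.2, p.2)
  have hsub : (Finset.univ : Finset (V × V × V)) ⊆ distinctTriples V ∪
      (Finset.univ.image f₁ ∪ (Finset.univ.image f₂ ∪ Finset.univ.image f₃)) := by
    rintro ⟨x, y, z⟩ -
    simp only [Finset.mem_union, mem_distinctTriples, Finset.mem_image, Finset.mem_univ, true_and,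
      Prod.exists, f₁, f₂, f₃, Prod.mk.injEq]
    grind
  have hcard := Finset.card_le_card hsub
  have h₀ := Finset.card_union_le (distinctTriples V)
    (Finset.univ.image f₁ ∪ (Finset.univ.image f₂ ∪ Finset.univ.image f₃))
  have h₁ := Finset.card_union_le (Finset.univ.image f₁)
    (Finset.univ.image f₂ ∪ Finset.univ.image f₃)
  have h₂ := Finset.card_union_le (Finset.univ.image f₂) (Finset.univ.image f₃)
  have k (f : V × V → V × V × V) : (Finset.univ.image f).card ≤ Fintype.card V ^ 2 := by
    refine Finset.card_image_le.trans ?_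
    simp [sq]
  have k₁ := k f₁
  have k₂ := k f₂
  have k₃ := k f₃
  have hV : (Finset.univ : Finset (V × V × V)).card = Fintype.card V ^ 3 := by
    simp [Fintype.card_prod]; ring
  omega

/-- The four faces of the blocks of a Steiner quadruple system cover the triples uniformly, so a
lower bound for the total weight of the faces of each block yields one for all triples. -/
theorem mul_card_distinctTriples_le {V : Type*} [Fintype V] [DecidableEq V]
    {B : Set (Finset V)} (hB : ∀ b ∈ B, b.card = 4)
    (hS : ∀ T : Finset V, T.card = 3 → ∃! b, b ∈ B ∧ T ⊆ b) (g : V → V → V → ℕ) (c : ℕ)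
    (hg : ∀ x y z w, {x, y, z, w} ∈ B → c ≤ g x y z + g x y w + g x w z + g w y z) :
    c * (distinctTriples V).card ≤ 4 * ∑ t ∈ distinctTriples V, g t.1 t.2.1 t.2.2 := by
  have hex : ∀ t : V × V × V, ∃ w, t ∈ distinctTriples V →
      w ∉ ({t.1, t.2.1, t.2.2} : Finset V) ∧ {t.1, t.2.1, t.2.2, w} ∈ B := by
    rintro ⟨x, y, z⟩
    by_cases ht : (x, y, z) ∈ distinctTriples V
    swap
    · exact ⟨x, fun h => absurd h ht⟩
    obtain ⟨hxy, hxz, hyz⟩ := mem_distinctTriples.1 ht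
    have h3 : ({x, y, z} : Finset V).card = 3 := Finset.card_eq_three.2 ⟨x, y, z, hxy, hxz, hyz, rfl⟩
    obtain ⟨b, ⟨hb, hTb⟩, -⟩ := hS _ h3
    have h1 : (b \ {x, y, z}).card = 1 := by
      rw [Finset.card_sdiff_of_subset hTb, hB b hb, h3]
    obtain ⟨w, hw⟩ := Finset.card_eq_one.1 h1
    have hwb : w ∈ b \ {x, y, z} := by simp [hw]
    refine ⟨w, fun _ => ⟨(Finset.mem_sdiff.1 hwb).2, ?_⟩⟩
    convert hb using 1
    rw [← Finset.sdiff_union_of_subset hTb, hw]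
    ext v
    simp only [Finset.mem_insert, Finset.mem_singleton, Finset.mem_union]
    tauto
  choose f hf using hex
  have huniq : ∀ x y z w, (x, y, z) ∈ distinctTriples V → w ∉ ({x, y, z} : Finset V) →
      {x, y, z, w} ∈ B → f (x, y, z) = w := by
    intro x y z w ht hw hwB
    obtain ⟨hxy, hxz, hyz⟩ := mem_distinctTriples.1 ht
    obtain ⟨hfn, hfB⟩ := hf _ ht
    have h3 : ({x, y, z} : Finset V).card = 3 := Finset.card_eq_three.2 ⟨x, y, z, hxy, hxz, hyz, rfl⟩
    have heq := (hS _ h3).unique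
      ⟨hfB, by intro v; simp only [Finset.mem_insert, Finset.mem_singleton]; tauto⟩
      ⟨hwB, by intro v; simp only [Finset.mem_insert, Finset.mem_singleton]; tauto⟩
    have hmem : f (x, y, z) ∈ ({x, y, z, w} : Finset V) := by
      rw [← heq]; simp
    simp only [Finset.mem_insert, Finset.mem_singleton] at hmem hfn
    tauto
  have hdata : ∀ x y z, (x, y, z) ∈ distinctTriples V →
      (x ≠ y ∧ x ≠ z ∧ y ≠ z) ∧
      (f (x, y, z) ≠ x ∧ f (x, y, z) ≠ y ∧ f (x, y, z) ≠ z) ∧ {x, y, z, f (x, y, z)} ∈ B := by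
    intro x y z ht
    obtain ⟨hfn, hfB⟩ := hf _ ht
    simp only [Finset.mem_insert, Finset.mem_singleton, not_or] at hfn
    exact ⟨mem_distinctTriples.1 ht, hfn, hfB⟩
  have hsum : ∀ φ : V × V × V → V × V × V, (∀ t ∈ distinctTriples V, φ t ∈ distinctTriples V) →
      (∀ t ∈ distinctTriples V, φ (φ t) = t) →
      ∑ t ∈ distinctTriples V, g (φ t).1 (φ t).2.1 (φ t).2.2 =
        ∑ t ∈ distinctTriples V, g t.1 t.2.1 t.2.2 := fun φ h₁ h₂ =>
    Finset.sum_nbij' φ φ h₁ h₁ h₂ h₂ fun _ _ => rfl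
  have hmem₁ : ∀ t ∈ distinctTriples V, (t.1, t.2.1, f t) ∈ distinctTriples V := by
    rintro ⟨x, y, z⟩ ht
    have := hdata x y z ht
    simp only [mem_distinctTriples]
    grind
  have hmem₂ : ∀ t ∈ distinctTriples V, (t.1, f t, t.2.2) ∈ distinctTriples V := by
    rintro ⟨x, y, z⟩ ht
    have := hdata x y z ht
    simp only [mem_distinctTriples]
    grind
  have hmem₃ : ∀ t ∈ distinctTriples V, (f t, t.2.1, t.2.2) ∈ distinctTriples V := by
    rintro ⟨x, y, z⟩ ht
    have := hdata x y z ht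
    simp only [mem_distinctTriples]
    grind
  have e₁ := hsum (fun t => (t.1, t.2.1, f t)) hmem₁ (by
    rintro ⟨x, y, z⟩ ht
    obtain ⟨hd, hfd, hfB⟩ := hdata x y z ht
    have : f (x, y, f (x, y, z)) = z := by
      refine huniq _ _ _ _ (hmem₁ _ ht) (by simp; tauto) ?_
      convert hfB using 1
      ext v; simp only [Finset.mem_insert, Finset.mem_singleton]; tauto
    simp [this])
  have e₂ := hsum (fun t => (t.1, f t, t.2.2)) hmem₂ (by
    rintro ⟨x, y, z⟩ ht
    obtain ⟨hd, hfd, hfB⟩ := hdata x y z ht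
    have : f (x, f (x, y, z), z) = y := by
      refine huniq _ _ _ _ (hmem₂ _ ht) (by simp; tauto) ?_
      convert hfB using 1
      ext v; simp only [Finset.mem_insert, Finset.mem_singleton]; tauto
    simp [this])
  have e₃ := hsum (fun t => (f t, t.2.1, t.2.2)) hmem₃ (by
    rintro ⟨x, y, z⟩ ht
    obtain ⟨hd, hfd, hfB⟩ := hdata x y z ht
    have : f (f (x, y, z), y, z) = x := by
      refine huniq _ _ _ _ (hmem₃ _ ht) (by simp; tauto) ?_
      convert hfB using 1
      ext v; simp only [Finset.mem_insert, Finset.mem_singleton]; tauto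
    simp [this])
  have hle : ∑ _t ∈ distinctTriples V, c ≤ ∑ t ∈ distinctTriples V,
      (g t.1 t.2.1 t.2.2 + g t.1 t.2.1 (f t) + g t.1 (f t) t.2.2 + g (f t) t.2.1 t.2.2) :=
    Finset.sum_le_sum fun t ht => hg _ _ _ _ (hf t ht).2
  simp only [Finset.sum_add_distrib, Finset.sum_const, smul_eq_mul] at hle
  rw [mul_comm]
  simp only at e₁ e₂ e₃
  omega

/-- If every block of a Steiner quadruple system on `n` points has two points at positions
differing by at least `22 n / 54`, then `n` is bounded. -/
theorem card_lt_of_spread_blocks {V : Type*} [Fintype V] [DecidableEq V] {n : ℕ}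
    (hn : Fintype.card V = n) {B : Set (Finset V)} (hB : ∀ b ∈ B, b.card = 4)
    (hS : ∀ T : Finset V, T.card = 3 → ∃! b, b ∈ B ∧ T ⊆ b) (pos : V → ℕ)
    (hinj : Function.Injective pos) (hlt : ∀ v, pos v < n)
    (hspread : ∀ b ∈ B, ∃ x ∈ b, ∃ y ∈ b, 54 * pos x + 22 * n ≤ 54 * pos y) :
    n < 1000000 := by
  by_contra! hlarge
  have hpos : 0 < n := by omega
  have hq : ∀ v, 54 * pos v / n < 54 := fun v => by
    rw [Nat.div_lt_iff_lt_mul hpos]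
    have := hlt v
    omega
  let cell : V → Fin 9 := fun v => ⟨cellIndex (54 * pos v / n), by
    have := hq v
    unfold cellIndex
    omega⟩
  have hupper := sum_triple_comp_le_of_card_fiber_le cell cellWidth tripleWeight
    (card_cell_le hpos pos hinj cell fun _ => rfl)
  rw [sum_tripleWeight] at hupper
  have hblock : ∀ b ∈ B, ∃ x ∈ b, ∃ y ∈ b, (cell x : ℕ) + 4 ≤ cell y := by
    intro b hb
    obtain ⟨x, hx, y, hy, hxy⟩ := hspread b hb
    refine ⟨x, hx, y, hy, ?_⟩
    have : 54 * pos x / n + 22 ≤ 54 * pos y / n := by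
      rw [← Nat.add_mul_div_right _ _ hpos]
      exact Nat.div_le_div_right hxy
    simp only [cell, cellIndex]
    omega
  have hlower := mul_card_distinctTriples_le hB hS
    (fun x y z => tripleWeight (cell x) (cell y) (cell z)) 8 (by
      intro x y z w hb
      obtain ⟨s, hs, t, ht, hst⟩ := hblock _ hb
      refine (eight_le_tripleWeight_sum (cell x) (cell y) (cell z) (cell w)).resolve_left ?_
      simp only [Finset.mem_insert, Finset.mem_singleton] at hs ht
      rcases hs with rfl | rfl | rfl | rfl <;> rcases ht with rfl | rfl | rfl | rfl <;> omega)
  have hsub : ∑ t ∈ distinctTriples V,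
      tripleWeight (cell t.1) (cell t.2.1) (cell t.2.2) ≤
      ∑ x, ∑ y, ∑ z, tripleWeight (cell x) (cell y) (cell z) := by
    simp only [← Fintype.sum_prod_type']
    exact Finset.sum_le_sum_of_subset (Finset.subset_univ _)
  have hcard := card_pow_three_le_card_distinctTriples (V := V)
  rw [hn] at hcard
  obtain ⟨m, rfl⟩ := Nat.exists_eq_add_of_le hlarge
  have hfinal : 54 ^ 3 * 2 * (1000000 + m) ^ 3 ≤
      (1000000 + m + 54) ^ 3 * 314808 + 54 ^ 3 * 6 * (1000000 + m) ^ 2 := by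
    omega
  ring_nf at hfinal
  omega

/-- if for infinitely many `n` there is a Steiner quadruple
system on `n` points with a `⌊α·n⌋`-good sequencing (where `0 < α < 1`),
then `α ≤ 1/√6`. -/
theorem stmt_18 (α : ℝ) (h0 : 0 < α) (h1 : α < 1)
    (h : {n : ℕ | 0 < n ∧ ∃ B : Set (Finset (Fin n)),
      (∀ b ∈ B, b.card = 4) ∧
      (∀ T : Finset (Fin n), T.card = 3 → ∃! b, b ∈ B ∧ T ⊆ b) ∧
      ∃ xs : List (Fin n), xs.Nodup ∧ (∀ v, v ∈ xs) ∧
        ∀ i m : ℕ, m ≤ ⌊α * (n : ℝ)⌋₊ →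
          ∀ b ∈ B, ¬ (∀ v ∈ b, v ∈ (xs.drop i).take m)}.Infinite) :
    α ≤ 1 / Real.sqrt 6 := by
  by_contra! hα
  have hα' : 11 / 27 < α := by
    refine lt_trans ?_ hα
    rw [lt_div_iff₀ (by positivity), ← lt_div_iff₀' (by norm_num), Real.sqrt_lt' (by norm_num)]
    norm_num
  obtain ⟨N, hN⟩ := exists_nat_gt (1 / (α - 11 / 27))
  obtain ⟨n, ⟨hn, B, hB, hS, xs, hnd, hall, hgood⟩, hnN⟩ := h.exists_gt (max N 1000000)
  obtain ⟨hnN, hlarge⟩ := max_lt_iff.1 hnN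
  have hlen : xs.length = n := by
    have huniv : xs.toFinset = Finset.univ := Finset.eq_univ_iff_forall.2 (by simpa using hall)
    rw [← List.toFinset_card_of_nodup hnd, huniv, Finset.card_univ, Fintype.card_fin]
  have hm : 22 * n / 54 + 1 ≤ ⌊α * (n : ℝ)⌋₊ := by
    refine Nat.le_floor ?_
    have hdiv : ((22 * n / 54 : ℕ) : ℝ) ≤ ((22 * n : ℕ) : ℝ) / (54 : ℕ) := Nat.cast_div_le
    have hnN' : (N : ℝ) < n := by exact_mod_cast hnN
    rw [div_lt_iff₀ (by linarith)] at hN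
    have : (N : ℝ) * (α - 11 / 27) ≤ n * (α - 11 / 27) :=
      mul_le_mul_of_nonneg_right hnN'.le (by linarith)
    push_cast at hdiv ⊢
    linarith
  have := card_lt_of_spread_blocks (Fintype.card_fin n) hB hS (fun v => xs.idxOf v)
    (fun v w hvw => (List.idxOf_inj (hall v)).1 hvw)
    (fun v => (List.idxOf_lt_length_of_mem (hall v)).trans_eq hlen)
    (by
      intro b hb
      by_contra! hclose
      obtain ⟨x, hx, hmin⟩ := Finset.exists_min_image b (fun v => xs.idxOf v)
        (Finset.card_pos.1 (by rw [hB b hb]; norm_num))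
      refine hgood (xs.idxOf x) _ hm b hb fun v hv => ?_
      have h₁ := hmin v hv
      have h₂ := hclose x hx v hv
      have h₃ := List.idxOf_lt_length_of_mem (hall v)
      rw [List.mem_iff_getElem]
      refine ⟨xs.idxOf v - xs.idxOf x, ?_, ?_⟩
      · simp only [List.length_take, List.length_drop]
        omega
      · simp only [List.getElem_take, List.getElem_drop]
        simp [Nat.add_sub_cancel' h₁])
  omega
end

section
/- Fix a partial Steiner triple system on a point set V of cardinality n, and let k be a positive integer such that the system contains k pairwise disjoint blocks but does not contain k+1 pairwise disjoint blocks. If n > 9k + 22·k^(2/3) + 10 (as real numbers), then the partial Steiner triple system is sequenceable. -/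
/-- Greedy construction of a sequence: if every admissible initial part can be extended by one
entry, then there is an admissible sequence of any length. -/
theorem exists_greedy_sequence {α : Type*} [Nonempty α] (N : ℕ) (Φ : ℕ → (ℕ → α) → α → Prop)
    (hcongr : ∀ j f g v, (∀ i < j, f i = g i) → Φ j f v → Φ j g v)
    (hstep : ∀ j < N, ∀ f : ℕ → α, (∀ i < j, Φ i f (f i)) → ∃ v, Φ j f v) :
    ∃ f : ℕ → α, ∀ j < N, Φ j f (f j) := by
  induction N with
  | zero => exact ⟨fun _ => Classical.arbitrary α, by simp⟩
  | succ N ih =>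
    obtain ⟨f, hf⟩ := ih fun j hj => hstep j (by omega)
    obtain ⟨v, hv⟩ := hstep N (by omega) f hf
    have key : ∀ j ≤ N, ∀ i < j, f i = Function.update f N v i := fun j hj i hi => by
      rw [Function.update_of_ne (by omega)]
    refine ⟨Function.update f N v, fun j hj => ?_⟩
    rcases Nat.lt_succ_iff_lt_or_eq.mp hj with h | rfl
    · rw [Function.update_of_ne (by omega)]
      exact hcongr j f _ _ (key j h.le) (hf j h)
    · rw [Function.update_self]
      exact hcongr j f _ _ (key j le_rfl) hv

/-- An interval of length at most `3 * s` contains at most `s` points at mutual distance at least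
`3`. -/
theorem card_le_of_spaced (C : Finset ℕ) (a s : ℕ) (hC : C ⊆ Finset.Ico a (a + 3 * s))
    (hsp : ∀ u ∈ C, ∀ v ∈ C, u < v → u + 3 ≤ v) : C.card ≤ s := by
  have h : C.card ≤ (Finset.range s).card := by
    refine Finset.card_le_card_of_injOn (fun u => (u - a) / 3) (fun u hu => ?_) ?_
    · have := Finset.mem_Ico.mp (hC hu)
      simp only [Finset.coe_range, Set.mem_Iio]
      omega
    · intro u hu v hv huv
      have h1 := Finset.mem_Ico.mp (hC hu)
      have h2 := Finset.mem_Ico.mp (hC hv)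
      have h3 := hsp u hu v hv
      have h4 := hsp v hv u hu
      simp only at huv
      omega
  simpa using h

/-- There is a set of `q` positions below `3 * q + q / m`, at mutual distance at least `3`, such
that only short intervals have a third of their positions in the set. -/
theorem exists_sparse_positions (q m : ℕ) (hm : 0 < m) :
    ∃ A : Finset ℕ, A.card = q ∧
      (∀ u ∈ A, ∀ v ∈ A, u < v → u + 3 ≤ v) ∧
      (∀ u ∈ A, u + 3 ≤ 3 * q + q / m) ∧
      ∀ a r, 0 < r → r ≤ (A ∩ Finset.Ico a (a + 3 * r)).card → r ≤ 3 * m := by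
  classical
  have hmono : ∀ i j, i < j → 3 * i + i / m + 3 ≤ 3 * j + j / m := fun i j hij => by
    have := Nat.div_le_div_right (c := m) hij.le
    omega
  have hinj : Function.Injective fun l => 3 * l + l / m := fun i j hij => by
    rcases lt_trichotomy i j with h | h | h
    · have := hmono i j h
      simp only at hij
      omega
    · exact h
    · have := hmono j i h
      simp only at hij
      omega
  refine ⟨(Finset.range q).image fun l => 3 * l + l / m, ?_, ?_, ?_, ?_⟩
  · rw [Finset.card_image_of_injective _ hinj, Finset.card_range]
  · simp only [Finset.mem_image, Finset.mem_range]
    rintro _ ⟨i, -, rfl⟩ _ ⟨j, -, rfl⟩ hij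
    refine hmono i j ?_
    by_contra! hji
    have := Nat.div_le_div_right (c := m) hji
    omega
  · simp only [Finset.mem_image, Finset.mem_range]
    rintro _ ⟨i, hi, rfl⟩
    exact hmono i q hi
  · intro a r hr hcard
    set I := (Finset.range q).filter fun l => 3 * l + l / m ∈ Finset.Ico a (a + 3 * r) with hI
    have hsub : ((Finset.range q).image fun l => 3 * l + l / m) ∩ Finset.Ico a (a + 3 * r) ⊆
        I.image fun l => 3 * l + l / m := by
      intro x hx
      obtain ⟨hx1, hx2⟩ := Finset.mem_inter.mp hx
      obtain ⟨l, hl, rfl⟩ := Finset.mem_image.mp hx1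
      exact Finset.mem_image_of_mem _ (Finset.mem_filter.mpr ⟨hl, hx2⟩)
    have hIr : r ≤ I.card :=
      hcard.trans ((Finset.card_le_card hsub).trans Finset.card_image_le)
    have hne : I.Nonempty := Finset.card_pos.mp (by omega)
    have hspan : I ⊆ Finset.Icc (I.min' hne) (I.max' hne) := fun l hl =>
      Finset.mem_Icc.mpr ⟨I.min'_le l hl, I.le_max' l hl⟩
    have hlen := Finset.card_le_card hspan
    rw [Nat.card_Icc] at hlen
    have hmin := Finset.mem_Ico.mp (Finset.mem_filter.mp (I.min'_mem hne)).2
    have hmax := Finset.mem_Ico.mp (Finset.mem_filter.mp (I.max'_mem hne)).2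
    generalize I.min' hne = i at *
    generalize I.max' hne = j at *
    by_contra! h
    have h1 : i / m + (r - 1) / m ≤ j / m :=
      Nat.div_add_div_le_add_div.trans (Nat.div_le_div_right (by omega))
    have h2 : 3 ≤ (r - 1) / m := (Nat.le_div_iff_mul_le hm).mpr (by omega)
    omega

/-- Two distinct points have at most one completion to a block. -/
theorem card_completions_le_one {V : Type*} [Fintype V] [DecidableEq V] (B : Set (Finset V))
    (hcard : ∀ b ∈ B, b.card = 3)
    (hint : ∀ b ∈ B, ∀ b' ∈ B, b ≠ b' → (b ∩ b').card ≤ 1) {x y : V} (hxy : x ≠ y)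
    [DecidablePred fun v => v ≠ x ∧ v ≠ y ∧ ∃ b ∈ B, v ∈ b ∧ x ∈ b ∧ y ∈ b] :
    (Finset.univ.filter fun v => v ≠ x ∧ v ≠ y ∧ ∃ b ∈ B, v ∈ b ∧ x ∈ b ∧ y ∈ b).card ≤ 1 := by
  rw [Finset.card_le_one]
  simp only [Finset.mem_filter, Finset.mem_univ, true_and]
  rintro v ⟨hvx, hvy, b, hb, hvb, hxb, hyb⟩ w ⟨hwx, hwy, b', hb', hwb, hxb', hyb'⟩
  have hbb : b = b' := by
    by_contra hne
    have h := Finset.card_le_one.mp (hint b hb b' hb' hne) x (Finset.mem_inter.mpr ⟨hxb, hxb'⟩) y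
      (Finset.mem_inter.mpr ⟨hyb, hyb'⟩)
    exact hxy h
  subst hbb
  by_contra hvw
  have hsub : ({v, w, x, y} : Finset V) ⊆ b := by
    intro z hz
    simp only [Finset.mem_insert, Finset.mem_singleton] at hz
    rcases hz with rfl | rfl | rfl | rfl <;> assumption
  have h4 : ({v, w, x, y} : Finset V).card = 4 := by
    rw [Finset.card_insert_of_notMem, Finset.card_insert_of_notMem, Finset.card_pair hxy] <;>
      simp [*]
  have := Finset.card_le_card hsub
  rw [h4, hcard b hb] at this
  omega

/-- The size condition leaves room for a spacing parameter `m`. -/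
theorem exists_spacing_parameter (n k : ℕ) (hk : 0 < k)
    (hn : (n : ℝ) > 9 * (k : ℝ) + 22 * (k : ℝ) ^ ((2 : ℝ) / 3) + 10) :
    ∃ m : ℕ, 0 < m ∧ 3 * (3 * k) + 3 * k / m + (2 * (3 * m) - 1) * (3 * m + 1) ≤ n := by
  obtain ⟨x, hx1, hx3, hx2⟩ : ∃ x : ℝ, 1 ≤ x ∧ x ^ 3 = k ∧ x ^ 2 = (k : ℝ) ^ ((2 : ℝ) / 3) := by
    refine ⟨(k : ℝ) ^ ((1 : ℝ) / 3), Real.one_le_rpow (by exact_mod_cast hk) (by norm_num), ?_, ?_⟩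
    · rw [← Real.rpow_natCast, ← Real.rpow_mul (by positivity)]
      norm_num
    · rw [← Real.rpow_natCast, ← Real.rpow_mul (by positivity)]
      norm_num
  rw [← hx2, ← hx3] at hn
  suffices h : ∃ m : ℕ, 0 < m ∧
      3 * x ^ 3 / m + (6 * m - 1) * (3 * m + 1) ≤ 22 * x ^ 2 + 10 by
    obtain ⟨m, hm, h⟩ := h
    refine ⟨m, hm, ?_⟩
    have hdiv : ((3 * k / m : ℕ) : ℝ) ≤ 3 * x ^ 3 / m := by
      rw [hx3]
      exact_mod_cast Nat.cast_div_le (α := ℝ) (m := 3 * k) (n := m)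
    have hsub : ((2 * (3 * m) - 1 : ℕ) : ℝ) = 6 * m - 1 := by
      rw [Nat.cast_sub (by omega)]
      push_cast
      ring
    have : ((3 * (3 * k) + 3 * k / m + (2 * (3 * m) - 1) * (3 * m + 1) : ℕ) : ℝ) ≤ n := by
      rw [Nat.cast_add, Nat.cast_add, Nat.cast_mul (2 * (3 * m) - 1), hsub]
      push_cast at hdiv ⊢
      linarith
    exact_mod_cast this
  rcases le_or_gt x 5 with h5 | h5
  · refine ⟨1, one_pos, ?_⟩
    norm_num
    nlinarith [mul_nonneg (sub_nonneg.mpr hx1) (sub_nonneg.mpr h5), sq_nonneg x,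
      mul_nonneg (sq_nonneg x) (sub_nonneg.mpr h5)]
  · have hceil := Nat.ceil_lt_add_one (show 0 ≤ x / 2 by positivity)
    have hle := Nat.le_ceil (x / 2)
    have hpos : 0 < ⌈x / 2⌉₊ := Nat.ceil_pos.mpr (by positivity)
    refine ⟨_, hpos, ?_⟩
    generalize (⌈x / 2⌉₊ : ℝ) = m at *
    have h1 : 3 * x ^ 3 / m ≤ 6 * x ^ 2 := by
      rw [div_le_iff₀ (by linarith)]
      nlinarith [mul_le_mul_of_nonneg_left hle (sq_nonneg x)]
    nlinarith [mul_nonneg (sub_nonneg.mpr hle) (sub_nonneg.mpr hceil.le)]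

/-- The number of pairs formed by a position outside `A` and one inside `A` near a position `j`. -/
theorem card_mul_card_window_le (A : Finset ℕ) (hA : ∀ u ∈ A, ∀ v ∈ A, u < v → u + 3 ≤ v)
    (R j : ℕ) (hR : 0 < R) (hj : j ∉ A) :
    (Finset.Ico (j + 1 - 3 * R) j \ A).card * (A ∩ Finset.Ico (j + 1 - 3 * R) (j + 2)).card ≤
      (2 * R - 1) * (R + 1) := by
  set W := Finset.Ico (j + 1 - 3 * R) j with hW
  have hsub : A ∩ Finset.Ico (j + 1 - 3 * R) (j + 2) ⊆ insert (j + 1) (A ∩ W) := by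
    intro u hu
    obtain ⟨huA, hu⟩ := Finset.mem_inter.mp hu
    rw [Finset.mem_Ico] at hu
    have : u ≠ j := fun h => hj (h ▸ huA)
    simp only [hW, Finset.mem_insert, Finset.mem_inter, Finset.mem_Ico]
    by_cases h : u = j + 1
    · exact Or.inl h
    · exact Or.inr ⟨huA, by omega⟩
  have h1 := (Finset.card_le_card hsub).trans (Finset.card_insert_le _ _)
  have h2 : (A ∩ W).card ≤ R := by
    refine card_le_of_spaced _ (j + 1 - 3 * R) R (fun u hu => ?_) fun u hu v hv =>
      hA u (Finset.mem_inter.mp hu).1 v (Finset.mem_inter.mp hv).1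
    have := Finset.mem_Ico.mp (Finset.mem_inter.mp hu).2
    exact Finset.mem_Ico.mpr (by omega)
  have h3 : (W \ A).card + (A ∩ W).card ≤ 3 * R - 1 := by
    rw [Finset.inter_comm, Finset.card_sdiff_add_card_inter, hW, Nat.card_Ico]
    omega
  refine (Nat.mul_le_mul_left _ h1).trans ?_
  generalize (A ∩ W).card = c at *
  generalize (W \ A).card = d at *
  obtain ⟨e, rfl⟩ := Nat.exists_eq_add_of_le h2
  have hd : d ≤ (2 * (c + e) - 1) + e := by omega
  refine (Nat.mul_le_mul_right _ hd).trans ?_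
  obtain ⟨t, ht⟩ : ∃ t, 2 * (c + e) - 1 = t := ⟨_, rfl⟩
  rw [ht]
  have het : e * (c + 1) ≤ e * t := by
    rcases Nat.eq_zero_or_pos e with rfl | he
    · simp
    · exact Nat.mul_le_mul_left e (by omega)
  nlinarith

/-- Placing the points of `P` at the positions in `A`, the remaining points can be arranged so
that no point outside `P`, at a position before `T`, is in a common block with an earlier point
outside `P` and a point of `P` that are both near it. -/
theorem exists_arrangement {V : Type*} [Fintype V] [DecidableEq V] (B : Set (Finset V))
    (hcard : ∀ b ∈ B, b.card = 3)
    (hint : ∀ b ∈ B, ∀ b' ∈ B, b ≠ b' → (b ∩ b').card ≤ 1)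
    (P : Finset V) (A : Finset ℕ) (hAP : A.card = P.card)
    (hA : ∀ u ∈ A, ∀ v ∈ A, u < v → u + 3 ≤ v) (T R : ℕ) (hR : 0 < R)
    (hAT : ∀ u ∈ A, u < T) (hT : T + (2 * R - 1) * (R + 1) ≤ Fintype.card V) :
    ∃ f : ℕ → V, (∀ i < Fintype.card V, ∀ j < Fintype.card V, f i = f j → i = j) ∧
      (∀ j < Fintype.card V, f j ∈ P ↔ j ∈ A) ∧
      ∀ j < T, j ∉ A → ∀ i ∈ Finset.Ico (j + 1 - 3 * R) j \ A,
        ∀ u ∈ A ∩ Finset.Ico (j + 1 - 3 * R) (j + 2),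
          ¬ ∃ b ∈ B, f j ∈ b ∧ f i ∈ b ∧ f u ∈ b := by
  classical
  have hpos : 0 < (2 * R - 1) * (R + 1) := Nat.mul_pos (by omega) (by omega)
  have hTn : T < Fintype.card V := by omega
  have : Nonempty V := Fintype.card_pos_iff.mp (by omega)
  let e := Finset.equivOfCardEq hAP
  obtain ⟨g, hgP, hginj⟩ : ∃ g : ℕ → V, (∀ j ∈ A, g j ∈ P) ∧
      ∀ i ∈ A, ∀ j ∈ A, g i = g j → i = j := by
    refine ⟨fun j => if h : j ∈ A then e ⟨j, h⟩ else Classical.arbitrary V, fun j hj => ?_,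
      fun i hi j hj hij => ?_⟩
    · simp [hj]
    · simp only [hi, hj, dite_true] at hij
      simpa using e.injective (Subtype.ext hij)
  obtain ⟨f, hf⟩ := exists_greedy_sequence (Fintype.card V)
    (fun j (f : ℕ → V) v => (j ∈ A → v = g j) ∧ (j ∉ A → v ∉ P ∧ (∀ i < j, v ≠ f i) ∧
      (j < T → ∀ i ∈ Finset.Ico (j + 1 - 3 * R) j \ A,
        ∀ u ∈ A ∩ Finset.Ico (j + 1 - 3 * R) (j + 2),
          ¬ ∃ b ∈ B, v ∈ b ∧ f i ∈ b ∧ g u ∈ b)))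
    (by
      rintro j f h v hfh ⟨h1, h2⟩
      refine ⟨h1, fun hj => ?_⟩
      obtain ⟨h3, h4, h5⟩ := h2 hj
      refine ⟨h3, fun i hi => hfh i hi ▸ h4 i hi, fun hjT i hi u hu => ?_⟩
      rw [← hfh i (Finset.mem_Ico.mp (Finset.mem_sdiff.mp hi).1).2]
      exact h5 hjT i hi u hu)
    (by
      intro j hj f hf
      by_cases hjA : j ∈ A
      · exact ⟨g j, fun _ => rfl, fun h => absurd hjA h⟩
      set W := Finset.Ico (j + 1 - 3 * R) j \ A with hW
      set U := A ∩ Finset.Ico (j + 1 - 3 * R) (j + 2) with hU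
      set bad : Finset V := if j < T then (W ×ˢ U).biUnion fun w =>
        Finset.univ.filter fun v => v ≠ f w.1 ∧ v ≠ g w.2 ∧
          ∃ b ∈ B, v ∈ b ∧ f w.1 ∈ b ∧ g w.2 ∈ b else ∅ with hbad
      have hbadcard : j < T → bad.card ≤ (2 * R - 1) * (R + 1) := by
        intro hjT
        rw [hbad, if_pos hjT]
        refine le_trans ?_ (card_mul_card_window_le A hA R j hR hjA)
        rw [← Finset.card_product]
        refine (Finset.card_biUnion_le_card_mul _ _ 1 fun w hw => ?_).trans (mul_one _).le
        obtain ⟨hw1, hw2⟩ := Finset.mem_product.mp hw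
        obtain ⟨hw1, hw1A⟩ := Finset.mem_sdiff.mp hw1
        refine card_completions_le_one B hcard hint fun h => ?_
        exact ((hf w.1 (Finset.mem_Ico.mp hw1).2).2 hw1A).1
          (h ▸ hgP _ (Finset.mem_inter.mp hw2).1)
      set used := (Finset.range j \ A).image f with hused
      have hlt : ∀ M, j < M → (∀ u ∈ A, u < M) → used.card < M - P.card := by
        intro M hjM hM
        have hAM : A ⊆ Finset.range M := fun u hu => Finset.mem_range.mpr (hM u hu)
        have h1 : (Finset.range M \ A).card = M - P.card := by
          rw [Finset.card_sdiff_of_subset hAM, Finset.card_range, hAP]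
        rw [← h1]
        refine Finset.card_image_le.trans_lt (Finset.card_lt_card ?_)
        refine Finset.ssubset_iff.mpr ⟨j, by simp, ?_⟩
        intro x hx
        rcases Finset.mem_insert.mp hx with rfl | hx
        · simp [hjM, hjA]
        · simp only [Finset.mem_sdiff, Finset.mem_range] at hx ⊢
          exact ⟨by omega, hx.2⟩
      have hcardlt : (P ∪ (used ∪ bad)).card < Fintype.card V := by
        have h1 := Finset.card_union_le P (used ∪ bad)
        have h2 := Finset.card_union_le used bad
        by_cases hjT : j < T
        · have h3 := hlt T hjT hAT
          have h4 := hbadcard hjT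
          omega
        · have h3 := hlt _ hj fun u hu => (hAT u hu).trans hTn
          have h4 : bad.card = 0 := by rw [hbad, if_neg hjT, Finset.card_empty]
          omega
      obtain ⟨v, -, hv⟩ := Finset.exists_mem_notMem_of_card_lt_card
        (hcardlt.trans_eq Finset.card_univ.symm)
      simp only [Finset.mem_union, not_or] at hv
      obtain ⟨hvP, hvu, hvb⟩ := hv
      have hnew : ∀ i < j, v ≠ f i := by
        rintro i hi rfl
        by_cases hiA : i ∈ A
        · exact hvP ((hf i hi).1 hiA ▸ hgP i hiA)
        · exact hvu (Finset.mem_image_of_mem f (by simp [hi, hiA]))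
      refine ⟨v, fun h => absurd h hjA, fun _ => ⟨hvP, hnew, fun hjT i hi u hu hb => hvb ?_⟩⟩
      rw [hbad, if_pos hjT]
      refine Finset.mem_biUnion.mpr ⟨(i, u), Finset.mem_product.mpr ⟨hi, hu⟩, ?_⟩
      simp only [Finset.mem_filter, Finset.mem_univ, true_and]
      refine ⟨hnew i (Finset.mem_Ico.mp (Finset.mem_sdiff.mp hi).1).2, ?_, hb⟩
      rintro rfl
      exact hvP (hgP u (Finset.mem_inter.mp hu).1))
  have hfP : ∀ j < Fintype.card V, f j ∈ P ↔ j ∈ A := by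
    intro j hj
    refine ⟨fun h => ?_, fun h => (hf j hj).1 h ▸ hgP j h⟩
    by_contra hjA
    exact ((hf j hj).2 hjA).1 h
  have hne : ∀ i j, i < j → j < Fintype.card V → f i ≠ f j := by
    intro i j hij hj h
    by_cases hjA : j ∈ A
    · have hiA : i ∈ A := (hfP i (hij.trans hj)).mp (h ▸ (hfP j hj).mpr hjA)
      rw [(hf j hj).1 hjA, (hf i (hij.trans hj)).1 hiA] at h
      exact hij.ne (hginj i hiA j hjA h)
    · exact ((hf j hj).2 hjA).2.1 i hij h.symm
  refine ⟨f, fun i hi j hj hij => ?_, hfP, fun j hj hjA i hi u hu => ?_⟩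
  · rcases lt_trichotomy i j with h | h | h
    · exact absurd hij (hne i j h hj)
    · exact h
    · exact absurd hij.symm (hne j i h hi)
  · have huA := (Finset.mem_inter.mp hu).1
    rw [(hf u ((hAT u huA).trans hTn)).1 huA]
    exact ((hf j (hj.trans hTn)).2 hjA).2.2 hj i hi u hu

/-- If each of `r` disjoint three-element sets meets `P`, and their union meets `P` in at most `r`
points, then each of them meets `P` in exactly one point. -/
theorem card_inter_eq_one_of_disjoint {V : Type*} [DecidableEq V] (S : Finset (Finset V))
    (P : Finset V) (hS : (S : Set (Finset V)).Pairwise (fun a b => Disjoint a b))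
    (hmeet : ∀ b ∈ S, (b ∩ P).Nonempty) :
    S.card ≤ (S.biUnion id ∩ P).card ∧
      ((S.biUnion id ∩ P).card ≤ S.card → ∀ b ∈ S, (b ∩ P).card = 1) := by
  have hsum : (S.biUnion id ∩ P).card = ∑ b ∈ S, (b ∩ P).card := by
    rw [Finset.biUnion_inter, Finset.card_biUnion]
    · rfl
    · intro a ha b hb hab
      exact (hS ha hb hab).mono Finset.inter_subset_left Finset.inter_subset_left
  have hle : ∀ b ∈ S, 1 ≤ (b ∩ P).card := fun b hb => Finset.card_pos.mpr (hmeet b hb)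
  have h1 : ∑ b ∈ S, 1 ≤ ∑ b ∈ S, (b ∩ P).card := Finset.sum_le_sum hle
  rw [hsum]
  refine ⟨by simpa using h1, fun h b hb => ?_⟩
  have h2 : ∑ b ∈ S, 1 = ∑ b ∈ S, (b ∩ P).card := le_antisymm h1 (by simpa using h)
  exact ((Finset.sum_eq_sum_iff_of_le hle).mp h2 b hb).symm

/-- a partial Steiner triple system on `n` points with a maximal
collection of `k` pairwise disjoint blocks is sequenceable provided
`n > 9k + 22·k^(2/3) + 10`. -/
theorem stmt_19 (V : Type) [Fintype V] [DecidableEq V] (n : ℕ)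
    (hV : Fintype.card V = n)
    (B : Set (Finset V))
    (hcard : ∀ b ∈ B, b.card = 3)
    (hint : ∀ b ∈ B, ∀ b' ∈ B, b ≠ b' → (b ∩ b').card ≤ 1)
    (k : ℕ) (hk : 0 < k)
    (hdisj : ∃ S : Finset (Finset V), ↑S ⊆ B ∧ S.card = k ∧
      (S : Set (Finset V)).Pairwise (fun a b => Disjoint a b))
    (hnodisj : ¬ ∃ S : Finset (Finset V), ↑S ⊆ B ∧ S.card = k + 1 ∧
      (S : Set (Finset V)).Pairwise (fun a b => Disjoint a b))
    (hn : (n : ℝ) > 9 * (k : ℝ) + 22 * (k : ℝ) ^ ((2 : ℝ) / 3) + 10) :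
    ∃ xs : List V, xs.Nodup ∧ (∀ v : V, v ∈ xs) ∧
      ∀ r : ℕ, 0 < r → ∀ i : ℕ, i + 3 * r ≤ xs.length →
        ¬ ∃ S : Finset (Finset V), ↑S ⊆ B ∧ S.card = r ∧
          (S : Set (Finset V)).Pairwise (fun a b => Disjoint a b) ∧
          (∀ v : V, v ∈ (xs.drop i).take (3 * r) ↔ ∃ b ∈ S, v ∈ b) := by
  classical
  obtain ⟨S₀, hS₀B, hS₀k, hS₀⟩ := hdisj
  subst hV
  set P : Finset V := S₀.biUnion id with hP
  have hPcard : P.card = 3 * k := by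
    rw [hP, Finset.card_biUnion (t := id) fun a ha b hb hab => hS₀ ha hb hab,
      Finset.sum_congr rfl fun b hb => show (id b).card = 3 from hcard b (hS₀B hb),
      Finset.sum_const, hS₀k, smul_eq_mul, mul_comm]
  have hmeet : ∀ b ∈ B, (b ∩ P).Nonempty := by
    intro b hb
    by_contra hne
    have hdis : ∀ a ∈ S₀, Disjoint b a := by
      intro a ha
      rw [Finset.not_nonempty_iff_eq_empty, ← Finset.disjoint_iff_inter_eq_empty] at hne
      exact hne.mono_right (Finset.subset_biUnion_of_mem id ha)
    have hbS : b ∉ S₀ := by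
      intro h
      have h0 := hcard b hb
      rw [disjoint_self.mp (hdis b h)] at h0
      simp at h0
    refine hnodisj ⟨insert b S₀, ?_, by rw [Finset.card_insert_of_notMem hbS, hS₀k], ?_⟩
    · rw [Finset.coe_insert]
      exact Set.insert_subset hb hS₀B
    · rw [Finset.coe_insert]
      exact hS₀.insert fun a ha _ => ⟨hdis a ha, (hdis a ha).symm⟩
  obtain ⟨m, hm, hsize⟩ := exists_spacing_parameter _ k hk hn
  obtain ⟨A, hAcard, hA, hAT, hAR⟩ := exists_sparse_positions (3 * k) m hm
  set T := 3 * (3 * k) + 3 * k / m with hT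
  obtain ⟨f, hinj, hfP, hfB⟩ := exists_arrangement B hcard hint P A (hAcard.trans hPcard.symm) hA
    T (3 * m) (by omega) (fun u hu => by have := hAT u hu; omega) hsize
  set N := Fintype.card V with hN
  have hnodup : ((List.range N).map f).Nodup :=
    List.nodup_range.map_on fun i hi j hj =>
      hinj i (List.mem_range.mp hi) j (List.mem_range.mp hj)
  have hsurj : ∀ v, ∃ j < N, f j = v := by
    have h : (Finset.range N).image f = Finset.univ := by
      refine Finset.eq_univ_of_card _ ?_
      rw [Finset.card_image_of_injOn, Finset.card_range]
      intro i hi j hj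
      exact hinj i (by simpa using hi) j (by simpa using hj)
    intro v
    have hv : v ∈ (Finset.range N).image f := h ▸ Finset.mem_univ v
    simpa using hv
  refine ⟨(List.range N).map f, hnodup, fun v => ?_, ?_⟩
  · simpa using hsurj v
  rintro r hr a har ⟨S, hSB, hSr, hS, hseg⟩
  rw [List.length_map, List.length_range] at har
  replace hseg : ∀ v, (∃ j, a ≤ j ∧ j < a + 3 * r ∧ f j = v) ↔ ∃ b ∈ S, v ∈ b := by
    intro v
    rw [← hseg v, List.mem_iff_getElem]
    simp only [List.getElem_take, List.getElem_drop, List.getElem_map, List.getElem_range,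
      List.length_take, List.length_drop, List.length_map, List.length_range]
    constructor
    · rintro ⟨j, h1, h2, rfl⟩
      exact ⟨j - a, by omega, by congr 1; omega⟩
    · rintro ⟨j, h1, rfl⟩
      exact ⟨a + j, by omega, by omega, rfl⟩
  have hcount : (S.biUnion id ∩ P).card = (A ∩ Finset.Ico a (a + 3 * r)).card := by
    have h : S.biUnion id ∩ P = (A ∩ Finset.Ico a (a + 3 * r)).image f := by
      ext v
      simp only [Finset.mem_inter, Finset.mem_biUnion, id, Finset.mem_image, Finset.mem_Ico]
      rw [← hseg v]
      constructor
      · rintro ⟨⟨j, h1, h2, rfl⟩, h3⟩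
        exact ⟨j, ⟨(hfP j (by omega)).mp h3, h1, h2⟩, rfl⟩
      · rintro ⟨j, ⟨h3, h1, h2⟩, rfl⟩
        exact ⟨⟨j, h1, h2, rfl⟩, (hfP j (by omega)).mpr h3⟩
    rw [h, Finset.card_image_of_injOn]
    intro i hi j hj
    have h1 := Finset.mem_Ico.mp (Finset.mem_inter.mp hi).2
    have h2 := Finset.mem_Ico.mp (Finset.mem_inter.mp hj).2
    exact hinj i (by omega) j (by omega)
  obtain ⟨hlow, hone⟩ := card_inter_eq_one_of_disjoint S P hS fun b hb => hmeet b (hSB hb)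
  have hupp : (A ∩ Finset.Ico a (a + 3 * r)).card ≤ r :=
    card_le_of_spaced _ a r Finset.inter_subset_right fun u hu v hv =>
      hA u (Finset.mem_inter.mp hu).1 v (Finset.mem_inter.mp hv).1
  rw [hcount, hSr] at hlow hone
  replace hone := hone hupp
  have hrm := hAR a r hr hlow
  have haT : a + 3 * r ≤ T := by
    by_contra! hlt
    have hTC : T ∉ A ∩ Finset.Ico a (a + 3 * r) := fun h => by
      have := hAT T (Finset.mem_inter.mp h).1
      omega
    obtain ⟨u, hu⟩ : (A ∩ Finset.Ico a (a + 3 * r)).Nonempty :=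
      Finset.card_pos.mp (by omega)
    have hu1 := hAT u (Finset.mem_inter.mp hu).1
    have hu2 := Finset.mem_Ico.mp (Finset.mem_inter.mp hu).2
    have h := card_le_of_spaced (insert T (A ∩ Finset.Ico a (a + 3 * r))) a r
      (Finset.insert_subset (Finset.mem_Ico.mpr (by omega)) Finset.inter_subset_right) (by
        intro x hx y hy hxy
        rcases Finset.mem_insert.mp hx with rfl | hx <;>
          rcases Finset.mem_insert.mp hy with rfl | hy
        · omega
        · have := hAT y (Finset.mem_inter.mp hy).1
          omega
        · exact hAT x (Finset.mem_inter.mp hx).1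
        · exact hA x (Finset.mem_inter.mp hx).1 y (Finset.mem_inter.mp hy).1 hxy)
    rw [Finset.card_insert_of_notMem hTC] at h
    omega
  have hQ : (Finset.Ico a (a + 3 * r) \ A).Nonempty := by
    have h := Finset.card_sdiff_add_card_inter (Finset.Ico a (a + 3 * r)) A
    rw [Finset.inter_comm, Nat.card_Ico] at h
    exact Finset.card_pos.mp (by omega)
  set j := (Finset.Ico a (a + 3 * r) \ A).max' hQ with hjdef
  obtain ⟨hjI, hjA⟩ := Finset.mem_sdiff.mp (Finset.max'_mem _ hQ)
  rw [← hjdef] at hjI hjA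
  rw [Finset.mem_Ico] at hjI
  have hjmax : ∀ i, a ≤ i → i < a + 3 * r → j < i → i ∈ A := by
    intro i h1 h2 h3
    by_contra hiA
    have := Finset.le_max' (Finset.Ico a (a + 3 * r) \ A) i (by simp [h1, h2, hiA])
    omega
  obtain ⟨b, hbS, hjb⟩ := (hseg (f j)).mp ⟨j, hjI.1, hjI.2, rfl⟩
  have hb1 := hone b hbS
  have hb2 := Finset.card_sdiff_add_card_inter b P
  rw [hb1, hcard b (hSB hbS)] at hb2
  obtain ⟨x, hx⟩ := Finset.card_pos.mp (hb1.symm ▸ one_pos)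
  obtain ⟨hxb, hxP⟩ := Finset.mem_inter.mp hx
  obtain ⟨u, hu1, hu2, rfl⟩ := (hseg x).mpr ⟨b, hbS, hxb⟩
  have huA : u ∈ A := (hfP u (by omega)).mp hxP
  obtain ⟨y, hy, hyj⟩ := Finset.exists_mem_ne (show 1 < (b \ P).card by omega) (f j)
  obtain ⟨hyb, hyP⟩ := Finset.mem_sdiff.mp hy
  obtain ⟨i, hi1, hi2, rfl⟩ := (hseg y).mpr ⟨b, hbS, hyb⟩
  have hiA : i ∉ A := fun h => hyP ((hfP i (by omega)).mpr h)
  have hij : i < j := by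
    have h1 : i ≠ j := fun h => hyj (h ▸ rfl)
    by_contra h2
    exact hiA (hjmax i hi1 hi2 (by omega))
  have huj : u < j + 2 := by
    by_contra! h
    have h1 := hjmax (j + 1) (by omega) (by omega) (by omega)
    have h2 := hjmax (j + 2) (by omega) (by omega) (by omega)
    have := hA _ h1 _ h2 (by omega)
    omega
  refine hfB j (by omega) hjA i ?_ u ?_ ⟨b, hSB hbS, hjb, hyb, hxb⟩
  · simp only [Finset.mem_sdiff, Finset.mem_Ico]
    exact ⟨by omega, hiA⟩
  · simp only [Finset.mem_inter, Finset.mem_Ico]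
    exact ⟨huA, by omega⟩
end
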